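/- arXiv:1401.5266 — 6 statements merged into one kernel-verified Lean document; each statement's English description precedes it below -/
import Mathlib

section
/- For every natural number n ≥ 9, the least common multiple of the integers 1, 2, …, n satisfies 2^n ≤ lcm{1,…,n} ≤ 2^{2n}. -/
open Nat in
theorem nair_aux_dvd (a b : ℕ) (hab : a ≤ b) :
    lcmUpto (a + b) ∣ lcmUpto b * (a + b).choose a := by
  have hc : (a + b).choose a ≠ 0 := (Nat.choose_pos (by omega)).ne'
  rw [← Nat.factorization_le_iff_dvd (lcmUpto_ne_zero _) (mul_ne_zero (lcmUpto_ne_zero _) hc)]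
  intro p
  by_cases hp : p.Prime
  swap
  · simp [Nat.factorization_eq_zero_of_not_prime _ hp]
  rw [Nat.factorization_mul (lcmUpto_ne_zero _) hc, Finsupp.add_apply,
    factorization_lcmUpto _ hp, factorization_lcmUpto _ hp,
    Nat.factorization_choose hp (by omega) (Nat.lt_succ_self _)]
  have : Finset.Ioc (Nat.log p b) (Nat.log p (a+b)) ⊆
      {i ∈ Finset.Ico 1 (Nat.log p (a+b)).succ | p ^ i ≤ a % p ^ i + (a + b - a) % p ^ i} := by
    intro i hi
    simp only [Finset.mem_Ioc] at hi
    have h1 : b < p ^ i := Nat.lt_pow_of_log_lt hp.one_lt hi.1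
    have h2 : p ^ i ≤ a + b := by
      apply Nat.pow_le_of_le_log _ hi.2
      intro h0
      rw [h0] at hi; simp at hi; omega
    simp only [Finset.mem_filter, Finset.mem_Ico]
    refine ⟨by omega, ?_⟩
    rw [Nat.add_sub_cancel_left, Nat.mod_eq_of_lt h1, Nat.mod_eq_of_lt (by omega)]
    exact h2
  have := Finset.card_le_card this
  rw [Nat.card_Ioc] at this
  omega

open Nat in
theorem nair_aux_mul_dvd (n m : ℕ) (hm : 1 ≤ m) (hmn : m ≤ n) :
    m * n.choose m ∣ lcmUpto n := by
  have hc : n.choose m ≠ 0 := (Nat.choose_pos (by omega)).ne'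
  have hm0 : m ≠ 0 := by omega
  rw [← Nat.factorization_le_iff_dvd (mul_ne_zero hm0 hc) (lcmUpto_ne_zero _)]
  intro p
  by_cases hp : p.Prime
  swap
  · simp [Nat.factorization_eq_zero_of_not_prime _ hp]
  rw [Nat.factorization_mul hm0 hc, Finsupp.add_apply,
    factorization_lcmUpto _ hp,
    Nat.factorization_choose hp (by omega) (Nat.lt_succ_self _)]
  have : {i ∈ Finset.Ico 1 (Nat.log p n).succ | p ^ i ≤ m % p ^ i + (n - m) % p ^ i} ⊆
      Finset.Ioc (m.factorization p) (Nat.log p n) := by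
    intro i hi
    simp only [Finset.mem_filter, Finset.mem_Ico] at hi
    simp only [Finset.mem_Ioc]
    refine ⟨?_, by omega⟩
    by_contra hlt
    have hd : p ^ i ∣ m := (pow_dvd_pow p (not_lt.mp hlt)).trans (Nat.ordProj_dvd m p)
    have h2 := hi.2
    rw [Nat.mod_eq_zero_of_dvd hd] at h2
    have := Nat.mod_lt (n - m) (pow_pos hp.pos i)
    omega
  have := Finset.card_le_card this
  rw [Nat.card_Ioc] at this
  have h3 : m.factorization p ≤ Nat.log p n :=
    Nat.le_log_of_pow_le hp.one_lt ((Nat.le_of_dvd hm (Nat.ordProj_dvd m p)).trans hmn)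
  omega

open Nat in
theorem nair_aux_upper (n : ℕ) : lcmUpto n ≤ 4 ^ n := by
  induction n using Nat.strong_induction_on with
  | _ n ih =>
  have key : ∀ a b, a ≤ b → lcmUpto (a + b) ≤ lcmUpto b * (a + b).choose a := fun a b h =>
    Nat.le_of_dvd (Nat.mul_pos (lcmUpto_pos _) (Nat.choose_pos (by omega))) (nair_aux_dvd a b h)
  rcases Nat.even_or_odd' n with ⟨m, rfl | rfl⟩
  · rcases Nat.eq_zero_or_pos m with rfl | hm
    · simp [lcmUpto]
    have h1 := key m m le_rfl
    have h2 := ih m (by omega)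
    have h3 : (m + m).choose m ≤ 4 ^ m := by
      have := Nat.choose_le_two_pow (m + m) m
      rwa [← two_mul, pow_mul, two_mul] at this
    calc lcmUpto (2 * m) ≤ 4 ^ m * 4 ^ m := by
          rw [two_mul]; exact h1.trans (Nat.mul_le_mul h2 h3)
      _ = _ := by rw [← pow_add, two_mul]
  · rcases Nat.eq_zero_or_pos m with rfl | hm
    · simp [lcmUpto]
    have h1 := key m (m + 1) (by omega)
    have h2 := ih (m + 1) (by omega)
    have e : m + (m + 1) = 2 * m + 1 := by ring
    rw [e] at h1
    have h3 := Nat.choose_middle_le_pow m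
    calc lcmUpto (2 * m + 1) ≤ 4 ^ (m + 1) * 4 ^ m := h1.trans (Nat.mul_le_mul h2 h3)
      _ = _ := by rw [← pow_add]; congr 1; ring

open Nat in
theorem nair_aux_mono {a b : ℕ} (h : a ≤ b) : lcmUpto a ∣ lcmUpto b :=
  Finset.lcm_mono (Finset.Icc_subset_Icc_right h)

open Nat in
theorem nair_aux_lower (m : ℕ) (hm : 4 ≤ m) : 2 ^ (2 * m + 2) ≤ lcmUpto (2 * m + 1) := by
  have h1 : m * (2 * m).choose m ∣ lcmUpto (2 * m + 1) :=
    (nair_aux_mul_dvd (2 * m) m (by omega) (by omega)).trans (nair_aux_mono (by omega))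
  have h2 : (2 * m + 1) * (2 * m).choose m ∣ lcmUpto (2 * m + 1) := by
    have := nair_aux_mul_dvd (2 * m + 1) (m + 1) (by omega) (by omega)
    rwa [mul_comm, ← Nat.add_one_mul_choose_eq] at this
  have h3 : m * (2 * m + 1) * (2 * m).choose m ∣ lcmUpto (2 * m + 1) := by
    have := Nat.lcm_dvd h1 h2
    rw [Nat.lcm_mul_right] at this
    have hco : Nat.Coprime m (2 * m + 1) := by simp
    rwa [hco.lcm_eq_mul] at this
  have h4 := Nat.le_of_dvd (lcmUpto_pos _) h3
  have h5 : 4 ^ m ≤ (2 * m + 1) * (2 * m).choose m := by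
    have := Nat.four_pow_le_two_mul_add_one_mul_central_binom m
    simpa [Nat.centralBinom] using this
  calc 2 ^ (2 * m + 2) = 4 * 4 ^ m := by rw [pow_add, pow_mul]; norm_num; ring
    _ ≤ m * ((2 * m + 1) * (2 * m).choose m) := Nat.mul_le_mul hm h5
    _ ≤ _ := by rwa [← mul_assoc]

/-- Nair's bound: for `n ≥ 9`, `2^n ≤ lcm{1,…,n} ≤ 2^(2n)`. -/
theorem nair_lcm_bound (n : ℕ) (hn : 9 ≤ n) :
    2 ^ n ≤ (Finset.Icc 1 n).lcm id ∧ (Finset.Icc 1 n).lcm id ≤ 2 ^ (2 * n) := by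
  change 2 ^ n ≤ Nat.lcmUpto n ∧ Nat.lcmUpto n ≤ 2 ^ (2 * n)
  constructor
  · have h := nair_aux_lower ((n - 1) / 2) (by omega)
    calc 2 ^ n ≤ 2 ^ (2 * ((n - 1) / 2) + 2) := Nat.pow_le_pow_right (by norm_num) (by omega)
      _ ≤ _ := h
      _ ≤ _ := Nat.le_of_dvd (Nat.lcmUpto_pos _) (nair_aux_mono (by omega))
  · rw [pow_mul]
    exact nair_aux_upper n
end

section
/- Let A be an m × n integer matrix and c ∈ ℤᵐ. Then there exist a finite index set I and, for each i ∈ I, a base vector bᵢ ∈ ℕⁿ and a finite set of period vectors Pᵢ ⊆ ℕⁿ, such that {x ∈ ℕⁿ : A·x ≥ c (componentwise)} = ⋃_{i∈I} L(bᵢ;Pᵢ), and for every i ∈ I, ‖bᵢ‖ ≤ (n‖A‖ + ‖c‖ + 2)^{m+n} and ‖p‖ ≤ (n‖A‖ + ‖c‖ + 2)^{m+n} for every p ∈ Pᵢ. -/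
open Finset in
theorem pot_pigeon {ι κ : Type*} [Fintype ι] [DecidableEq ι] [Fintype κ] [DecidableEq κ]
    (M : κ → ι → ℤ) (s H : ℕ) (S : Finset ι)
    (hs : 1 ≤ s) (hM : ∀ k, ∑ j, |M k j| ≤ s) (hcard : Fintype.card κ < S.card)
    (hH : s ^ Fintype.card κ ≤ H) :
    ∃ w : ι → ℤ, w ≠ 0 ∧ (∀ j, j ∉ S → w j = 0) ∧ (∀ j, |w j| ≤ H) ∧
      ∀ k, ∑ j, M k j * w j = 0 := by
  classical
  let dom : Finset (ι → ℤ) := Fintype.piFinset fun j => if j ∈ S then Icc 0 (H : ℤ) else {0}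
  let cod : Finset (κ → ℤ) := Fintype.piFinset fun k =>
    Icc (-(∑ j, (M k j)⁻ * (H : ℤ))) (∑ j, (M k j)⁺ * (H : ℤ))
  have hdom : dom.card = (H + 1) ^ S.card := by
    simp only [dom, Fintype.card_piFinset, apply_ite Finset.card]
    rw [Finset.prod_ite]
    simp
  have hcod : cod.card ≤ (s * H + 1) ^ Fintype.card κ := by
    simp only [cod, Fintype.card_piFinset]
    refine (Finset.prod_le_prod' (g := fun _ => s * H + 1) ?_).trans (by simp)
    intro k _
    rw [Int.card_Icc]
    have : (∑ j, (M k j)⁺ * (H : ℤ)) + (∑ j, (M k j)⁻ * (H : ℤ)) ≤ s * H := by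
      rw [← Finset.sum_add_distrib]
      calc _ = (∑ j, |M k j|) * (H : ℤ) := by
            rw [Finset.sum_mul]
            refine Finset.sum_congr rfl fun j _ => ?_
            rw [← posPart_add_negPart (M k j)]; ring
        _ ≤ _ := by gcongr; exact hM k
    have h0 : (0 : ℤ) ≤ (s : ℤ) * H := by positivity
    zify
    omega
  have hlt : cod.card < dom.card := by
    rw [hdom]
    refine hcod.trans_lt ?_
    calc (s * H + 1) ^ Fintype.card κ ≤ (s * (H + 1)) ^ Fintype.card κ := by
          gcongr; nlinarith
      _ = s ^ Fintype.card κ * (H + 1) ^ Fintype.card κ := by rw [mul_pow]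
      _ < (H + 1) * (H + 1) ^ Fintype.card κ := by gcongr; omega
      _ = (H + 1) ^ (Fintype.card κ + 1) := by ring
      _ ≤ _ := by gcongr <;> omega
  have hb : ∀ u ∈ dom, ∀ j, 0 ≤ u j ∧ u j ≤ H ∧ (j ∉ S → u j = 0) := by
    intro u hu j
    have := Fintype.mem_piFinset.1 hu j
    split_ifs at this with h
    · simp at this; exact ⟨this.1, this.2, fun h' => absurd h h'⟩
    · simp at this; simp [this]
  obtain ⟨u, hu, v, hv, huv, he⟩ := Finset.exists_ne_map_eq_of_card_lt_of_maps_to hlt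
    (f := fun u k => ∑ j, M k j * u j) (by
      intro u hu
      have hu := hb u hu
      refine Fintype.mem_piFinset.2 fun k => Finset.mem_Icc.2 ⟨?_, ?_⟩
      · rw [← Finset.sum_neg_distrib]
        refine Finset.sum_le_sum fun j _ => ?_
        have h1 : -(M k j)⁻ ≤ M k j := neg_le.1 (neg_le_negPart _)
        have h2 := negPart_nonneg (M k j)
        obtain ⟨h3, h4, _⟩ := hu j
        nlinarith
      · refine Finset.sum_le_sum fun j _ => ?_
        have h1 : M k j ≤ (M k j)⁺ := le_posPart _
        have h2 := posPart_nonneg (M k j)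
        obtain ⟨h3, h4, _⟩ := hu j
        nlinarith)
  refine ⟨u - v, sub_ne_zero.2 huv, ?_, ?_, ?_⟩
  · intro j hj
    simp [(hb u hu j).2.2 hj, (hb v hv j).2.2 hj]
  · intro j
    have h1 := hb u hu j
    have h2 := hb v hv j
    simp only [Pi.sub_apply, abs_le]
    constructor <;> omega
  · intro k
    have := congrFun he k
    simp only [Pi.sub_apply, mul_sub, Finset.sum_sub_distrib]
    simpa [sub_eq_zero] using this

/-- A small kernel vector supported on the support of `z`. -/
theorem pot_ker {ι : Type*} [Fintype ι] [DecidableEq ι] {m : ℕ}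
    (M : Fin m → ι → ℤ) (s : ℕ) (hs : 1 ≤ s) (hM : ∀ k, ∑ j, |M k j| ≤ s)
    (z : ι → ℚ) (hz : z ≠ 0) (hk : ∀ k, ∑ j, (M k j : ℚ) * z j = 0) :
    ∃ w : ι → ℤ, w ≠ 0 ∧ (∀ j, z j = 0 → w j = 0) ∧ (∀ j, |w j| ≤ (s ^ m : ℕ)) ∧
      ∀ k, ∑ j, M k j * w j = 0 := by
  classical
  let S : Finset ι := Finset.univ.filter fun j => z j ≠ 0
  let v : Fin m → (S → ℚ) := fun k j => (M k j : ℚ)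
  obtain ⟨κ, a, ha, hspan, hli⟩ := exists_linearIndependent' ℚ v
  have : Finite κ := Finite.of_injective a ha
  have : Fintype κ := Fintype.ofFinite κ
  -- functionals
  have sumS : ∀ (f : ι → ℚ) (y : ι → ℚ), (∀ j, j ∉ S → y j = 0) →
      ∑ j : S, f j * y j = ∑ j, f j * y j := by
    intro f y hy
    rw [Finset.sum_coe_sort S (fun j => f j * y j)]
    refine Finset.sum_subset (Finset.subset_univ _) ?_
    intro j _ hj
    rw [hy j hj, mul_zero]
  let φ : (ι → ℚ) → ((S → ℚ) →ₗ[ℚ] ℚ) := fun y =>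
    { toFun := fun f => ∑ j : S, f j * y j
      map_add' := by intro f g; simp [add_mul, Finset.sum_add_distrib]
      map_smul' := by intro r f; simp [mul_assoc, Finset.mul_sum] }
  have hzS : ∀ j, j ∉ S → z j = 0 := by intro j hj; simpa [S] using hj
  have hcard : Fintype.card κ < S.card := by
    have h1 : Fintype.card κ = Module.finrank ℚ (Submodule.span ℚ (Set.range (v ∘ a))) :=
      (finrank_span_eq_card hli).symm
    have hne : Submodule.span ℚ (Set.range (v ∘ a)) ≠ ⊤ := by
      rw [hspan]
      intro htop
      have hle : Submodule.span ℚ (Set.range v) ≤ LinearMap.ker (φ z) := by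
        rw [Submodule.span_le]
        rintro _ ⟨k, rfl⟩
        simp only [SetLike.mem_coe, LinearMap.mem_ker]
        change ∑ j : S, (M k j : ℚ) * z j = 0
        rw [sumS (fun j => (M k j : ℚ)) z hzS]; exact hk k
      rw [htop] at hle
      obtain ⟨j, hj⟩ := Function.ne_iff.1 hz
      have hjS : j ∈ S := by simpa [S] using hj
      have := hle (Submodule.mem_top (x := Pi.single (⟨j, hjS⟩ : S) (1:ℚ)))
      rw [LinearMap.mem_ker] at this
      change ∑ i : S, (Pi.single (⟨j, hjS⟩ : S) (1:ℚ) : S → ℚ) i * z i = 0 at this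
      rw [Finset.sum_eq_single (⟨j, hjS⟩ : S)] at this
      · simp at this; exact hj this
      · intro b _ hb; simp [hb]
      · simp
    have h2 := Submodule.finrank_lt hne
    rw [h1]
    simpa using h2
  have hκ : Fintype.card κ ≤ m := by
    simpa using Fintype.card_le_of_injective a ha
  obtain ⟨w, hw, hwS, hwH, hwk⟩ := pot_pigeon (fun k => M (a k)) s (s ^ m) S hs
    (fun k => hM _) hcard (Nat.pow_le_pow_right hs hκ)
  refine ⟨w, hw, ?_, hwH, ?_⟩
  · intro j hj; exact hwS j (by simp [S, hj])
  · intro k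
    have hwS' : ∀ j, j ∉ S → (w j : ℚ) = 0 := fun j hj => by simp [hwS j hj]
    have hle : Submodule.span ℚ (Set.range v) ≤ LinearMap.ker (φ fun j => (w j : ℚ)) := by
      rw [← hspan, Submodule.span_le]
      rintro _ ⟨k, rfl⟩
      simp only [SetLike.mem_coe, LinearMap.mem_ker]
      change ∑ j : S, (M (a k) j : ℚ) * (w j : ℚ) = 0
      rw [sumS (fun j => (M (a k) j : ℚ)) (fun j => (w j : ℚ)) hwS']
      exact_mod_cast hwk k
    have h := hle (Submodule.subset_span ⟨k, rfl⟩)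
    rw [LinearMap.mem_ker] at h
    change ∑ j : S, (M k j : ℚ) * (w j : ℚ) = 0 at h
    rw [sumS (fun j => (M k j : ℚ)) (fun j => (w j : ℚ)) hwS'] at h
    exact_mod_cast h

/-- Ratio test. -/
theorem pot_ratio {ι : Type*} [Fintype ι] [DecidableEq ι] (z : ι → ℚ) (hz : ∀ j, 0 ≤ z j)
    (w : ι → ℤ) (hw : ∀ j, z j = 0 → w j = 0) (hp : ∃ j, 0 < w j) :
    ∃ l : ℚ, 0 < l ∧ (∀ j, 0 ≤ z j - l * w j) ∧
      (Finset.univ.filter fun j => z j - l * w j ≠ 0).card <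
        (Finset.univ.filter fun j => z j ≠ 0).card := by
  classical
  obtain ⟨j0, hj0, hmin⟩ := Finset.exists_min_image (Finset.univ.filter fun j => 0 < w j)
    (fun j => z j / w j) (by obtain ⟨j, hj⟩ := hp; exact ⟨j, by simpa using hj⟩)
  simp only [Finset.mem_filter, Finset.mem_univ, true_and] at hj0 hmin
  have hw0 : (0 : ℚ) < w j0 := by exact_mod_cast hj0
  have hz0 : z j0 ≠ 0 := fun h => by have := hw _ h; omega
  have hz0' : 0 < z j0 := lt_of_le_of_ne (hz j0) (Ne.symm hz0)
  have hl : 0 < z j0 / w j0 := by positivity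
  refine ⟨z j0 / w j0, hl, ?_, ?_⟩
  · intro j
    by_cases hj : 0 < w j
    · have h := hmin j hj
      have hj' : (0 : ℚ) < w j := by exact_mod_cast hj
      rw [le_div_iff₀ hj'] at h
      linarith
    · have hj' : (w j : ℚ) ≤ 0 := by exact_mod_cast not_lt.1 hj
      have := hz j
      nlinarith
  · refine Finset.card_lt_card ⟨?_, ?_⟩
    · intro j hj
      simp only [Finset.mem_filter, Finset.mem_univ, true_and] at hj ⊢
      intro h
      apply hj
      simp [h, hw j h]
    · intro h
      have := h (show j0 ∈ _ by simpa using hz0)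
      simp only [Finset.mem_filter, Finset.mem_univ, true_and] at this
      apply this
      field_simp
      simp

theorem pot_circ {ι : Type*} [Fintype ι] [DecidableEq ι] {m : ℕ}
    (M : Fin m → ι → ℤ) (s : ℕ) (hs : 1 ≤ s) (hM : ∀ k, ∑ j, |M k j| ≤ s) (d : ℕ) :
    ∀ (z : ι → ℚ), (Finset.univ.filter fun j => z j ≠ 0).card ≤ d → z ≠ 0 → (∀ j, 0 ≤ z j) →
      (∀ k, ∑ j, (M k j : ℚ) * z j = 0) →
    ∃ w : ι → ℤ, w ≠ 0 ∧ (∀ j, z j = 0 → w j = 0) ∧ (∀ j, 0 ≤ w j) ∧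
      (∀ j, w j ≤ (s ^ m : ℕ)) ∧ ∀ k, ∑ j, M k j * w j = 0 := by
  induction d with
  | zero =>
    intro z hc hz
    exfalso
    apply hz
    ext j
    by_contra h
    have h2 := Finset.card_eq_zero.1 (Nat.le_zero.1 hc)
    have : j ∈ (Finset.univ.filter fun j => z j ≠ 0) := by simpa using h
    rw [h2] at this
    simp at this
  | succ d ih =>
    intro z hc hz hpos hk
    have key : ∃ w : ι → ℤ, (∃ j, 0 < w j) ∧ (∀ j, z j = 0 → w j = 0) ∧
        (∀ j, |w j| ≤ (s ^ m : ℕ)) ∧ ∀ k, ∑ j, M k j * w j = 0 := by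
      obtain ⟨w, hw, hw0, hwH, hwk⟩ := pot_ker M s hs hM z hz hk
      obtain ⟨j, hj⟩ := Function.ne_iff.1 hw
      rcases lt_or_gt_of_ne hj with h | h
      · refine ⟨-w, ⟨j, by simpa using h⟩, ?_, ?_, ?_⟩
        · intro j hj; simp [hw0 j hj]
        · intro j; simpa using hwH j
        · intro k; simp [hwk k]
      · exact ⟨w, ⟨j, by simpa using h⟩, hw0, hwH, hwk⟩
    obtain ⟨w, hw, hw0, hwH, hwk⟩ := key
    by_cases hn : ∀ j, 0 ≤ w j
    · refine ⟨w, ?_, hw0, hn, fun j => (le_abs_self _).trans (hwH j), hwk⟩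
      rintro rfl
      simp at hw
    · push Not at hn
      obtain ⟨j1, hj1⟩ := hn
      obtain ⟨l, hl, hl0, hlc⟩ := pot_ratio z hpos w hw0 hw
      obtain ⟨g, hg, hg0, hg1, hg2, hg3⟩ := ih (fun j => z j - l * w j) (by omega) (by
          intro h
          have := congrFun h j1
          simp only [Pi.zero_apply] at this
          have h1 : (w j1 : ℚ) < 0 := by exact_mod_cast hj1
          have := hpos j1
          nlinarith) hl0 (by
          intro k
          have h1 := hk k
          have h2 : ∑ j, (M k j : ℚ) * w j = 0 := by exact_mod_cast hwk k
          calc _ = ∑ j, (M k j : ℚ) * z j - l * ∑ j, (M k j : ℚ) * w j := by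
                rw [Finset.mul_sum, ← Finset.sum_sub_distrib]
                refine Finset.sum_congr rfl fun j _ => by ring
            _ = 0 := by rw [h1, h2]; ring)
      refine ⟨g, hg, ?_, hg1, hg2, hg3⟩
      intro j hj
      apply hg0
      simp [hj, hw0 j hj]

theorem pot_dec {ι : Type*} [Fintype ι] [DecidableEq ι] {m : ℕ}
    (M : Fin m → ι → ℤ) (s : ℕ) (hs : 1 ≤ s) (hM : ∀ k, ∑ j, |M k j| ≤ s) (t : ι) (d : ℕ) :
    ∀ (z : ι → ℚ), (Finset.univ.filter fun j => z j ≠ 0).card ≤ d → (∀ j, 0 ≤ z j) →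
      (∀ k, ∑ j, (M k j : ℚ) * z j = 0) → z t ≤ 1 →
    (∀ j, z j ≤ d * (s ^ m : ℕ)) ∨
    ∃ w : ι → ℤ, w ≠ 0 ∧ w t = 0 ∧ (∀ j, 0 ≤ w j) ∧ (∀ j, (w j : ℚ) ≤ z j) ∧
      (∀ j, w j ≤ (s ^ m : ℕ)) ∧ ∀ k, ∑ j, M k j * w j = 0 := by
  induction d with
  | zero =>
    intro z hc _ _ _
    left
    intro j
    by_contra h
    have h2 := Finset.card_eq_zero.1 (Nat.le_zero.1 hc)
    have : j ∈ (Finset.univ.filter fun j => z j ≠ 0) := by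
      simp only [Finset.mem_filter, Finset.mem_univ, true_and]
      intro h0
      simp [h0] at h
    rw [h2] at this
    simp at this
  | succ d ih =>
    intro z hc hpos hk ht
    by_cases hz : z = 0
    · left; intro j; rw [hz]; simp only [Pi.zero_apply]; positivity
    obtain ⟨g, hg, hg0, hg1, hg2, hg3⟩ := pot_circ M s hs hM (d+1) z hc hz hpos hk
    have hgp : ∃ j, 0 < g j := by
      obtain ⟨j, hj⟩ := Function.ne_iff.1 hg
      exact ⟨j, lt_of_le_of_ne (hg1 j) (Ne.symm hj)⟩
    obtain ⟨l, hl, hl0, hlc⟩ := pot_ratio z hpos g hg0 hgp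
    have hgq : ∀ j, (0 : ℚ) ≤ g j := fun j => by exact_mod_cast hg1 j
    by_cases hcase : 1 ≤ l ∧ g t = 0
    · right
      refine ⟨g, hg, hcase.2, hg1, ?_, hg2, hg3⟩
      intro j
      have := hl0 j
      nlinarith [hgq j, hcase.1]
    have hl1 : l ≤ 1 := by
      by_contra h
      push Not at h
      have h1 : g t ≠ 0 := fun h0 => hcase ⟨h.le, h0⟩
      have h2 : 1 ≤ g t := by have := hg1 t; omega
      have h3 : (1 : ℚ) ≤ g t := by exact_mod_cast h2
      have := hl0 t
      nlinarith
    rcases ih (fun j => z j - l * g j) (by omega) hl0 (by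
          intro k
          have h1 := hk k
          have h2 : ∑ j, (M k j : ℚ) * g j = 0 := by exact_mod_cast hg3 k
          calc _ = ∑ j, (M k j : ℚ) * z j - l * ∑ j, (M k j : ℚ) * g j := by
                rw [Finset.mul_sum, ← Finset.sum_sub_distrib]
                refine Finset.sum_congr rfl fun j _ => by ring
            _ = 0 := by rw [h1, h2]; ring) (by
          have := mul_nonneg hl.le (hgq t)
          linarith) with h | ⟨w, h1, h2, h3, h4, h5, h6⟩
    · left
      intro j
      have h1 := h j
      have h2 : (g j : ℚ) ≤ (s ^ m : ℕ) := by exact_mod_cast hg2 j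
      have h3 := hgq j
      have h4 : l * g j ≤ g j := by nlinarith
      push_cast at *
      linarith
    · right
      refine ⟨w, h1, h2, h3, ?_, h5, h6⟩
      intro j
      have := h4 j
      have := mul_nonneg hl.le (hgq j)
      linarith

theorem pot_arith (m n s : ℕ) (hs : 1 ≤ s) (hn : 1 ≤ n) :
    (n + m + 1) * s ^ m ≤ (s + 1) ^ (m + n) := by
  obtain ⟨n, rfl⟩ : ∃ k, n = k + 1 := ⟨n - 1, by omega⟩
  have h1 : (s + m) * s ^ m ≤ s * (s + 1) ^ m := by
    clear hn
    induction m with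
    | zero => simp
    | succ m ih =>
      have h3 : (s + (m + 1)) * s ≤ (s + m) * (s + 1) := by nlinarith
      calc (s + (m + 1)) * s ^ (m + 1) = ((s + (m + 1)) * s) * s ^ m := by ring
        _ ≤ ((s + m) * (s + 1)) * s ^ m := by gcongr
        _ = ((s + m) * s ^ m) * (s + 1) := by ring
        _ ≤ (s * (s + 1) ^ m) * (s + 1) := by gcongr
        _ = _ := by ring
  have h2 : (m + 2) * s ^ m ≤ (s + 1) ^ (m + 1) := by
    have h4 : s ^ m ≤ (s + 1) ^ m := by gcongr; omega
    rw [pow_succ]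
    nlinarith [Nat.zero_le (s ^ m), mul_le_mul_left hs (s ^ m)]
  have h5 : n + 1 ≤ 2 ^ n := Nat.lt_two_pow_self
  calc (n + 1 + m + 1) * s ^ m ≤ ((n + 1) * (m + 2)) * s ^ m := by gcongr; nlinarith
    _ = (n + 1) * ((m + 2) * s ^ m) := by ring
    _ ≤ (s + 1) ^ n * (s + 1) ^ (m + 1) := by
        gcongr
        exact h5.trans (Nat.pow_le_pow_left (by omega) n)
    _ = _ := by ring

theorem pot_step (m n : ℕ) (A : Matrix (Fin m) (Fin n) ℤ) (c : Fin m → ℤ) (a γ : ℕ)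
    (hA : ∀ i j, |A i j| ≤ a) (hc : ∀ i, |c i| ≤ γ)
    (x : Fin n → ℕ) (hx : ∀ i, c i ≤ ∑ j, A i j * (x j : ℤ)) :
    (∀ j, x j ≤ (n * a + γ + 2) ^ (m + n)) ∨
    ∃ p : Fin n → ℕ, p ≠ 0 ∧ p ≤ x ∧ (∀ j, p j ≤ (n * a + γ + 2) ^ (m + n)) ∧
      (∀ i, 0 ≤ ∑ j, A i j * (p j : ℤ)) ∧
      (∀ i, c i ≤ ∑ j, A i j * ((x - p) j : ℤ)) := by
  classical
  rcases Nat.eq_zero_or_pos n with rfl | hn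
  · left; intro j; exact j.elim0
  have har := pot_arith m n (n * a + γ + 1) (by omega) hn
  have hsm : (n * a + γ + 1) ^ m ≤ (n * a + γ + 2) ^ (m + n) := by
    refine le_trans ?_ har
    exact Nat.le_mul_of_pos_left _ (by omega)
  let M : Fin m → ((Fin n ⊕ Fin m) ⊕ Unit) → ℤ := fun i =>
    Sum.elim (Sum.elim (A i) (fun k => if k = i then -1 else 0)) (fun _ => - c i)
  let y : Fin m → ℤ := fun i => ∑ j, A i j * (x j : ℤ) - c i
  let z : ((Fin n ⊕ Fin m) ⊕ Unit) → ℚ :=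
    Sum.elim (Sum.elim (fun j => (x j : ℚ)) (fun k => (y k : ℚ))) (fun _ => 1)
  have hMs : ∀ k, ∑ j, |M k j| ≤ ((n * a + γ + 1 : ℕ) : ℤ) := by
    intro k
    simp only [M, Fintype.sum_sum_type, Sum.elim_inl, Sum.elim_inr, abs_neg, apply_ite abs]
    have : ∑ j, |A k j| ≤ n * a := by
      refine (Finset.sum_le_card_nsmul _ _ (a : ℤ) (fun j _ => hA k j)).trans ?_
      simp
    have := hc k
    simp
    linarith
  have hy : ∀ k, 0 ≤ y k := fun k => sub_nonneg.2 (hx k)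
  have hdec := pot_dec M (n * a + γ + 1) (by omega) hMs (Sum.inr ()) (n + m + 1) z
    (by
      refine (Finset.card_filter_le _ _).trans ?_
      simp)
    (by
      rintro ((j | k) | u)
      · simp [z]
      · simpa [z] using hy k
      · simp [z])
    (by
      intro k
      simp only [M, z, y, Fintype.sum_sum_type, Sum.elim_inl, Sum.elim_inr]
      simp)
    (by simp [z])
  rcases hdec with h | ⟨w, h1, h2, h3, h4, h5, h6⟩
  · left
    intro j
    have := h (Sum.inl (Sum.inl j))
    simp only [z, Sum.elim_inl] at this
    have h' : x j ≤ (n + m + 1) * (n * a + γ + 1) ^ m := by exact_mod_cast this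
    exact h'.trans har
  · right
    have hrow : ∀ k, ∑ j, A k j * w (Sum.inl (Sum.inl j)) = w (Sum.inl (Sum.inr k)) := by
      intro k
      have := h6 k
      simp only [M, Fintype.sum_sum_type, Sum.elim_inl, Sum.elim_inr] at this
      simp [h2] at this
      linarith
    have hcast : ∀ j, ((w (Sum.inl (Sum.inl j))).toNat : ℤ) = w (Sum.inl (Sum.inl j)) :=
      fun j => Int.toNat_of_nonneg (h3 _)
    have hple : ∀ j, (w (Sum.inl (Sum.inl j))).toNat ≤ x j := by
      intro j
      have := h4 (Sum.inl (Sum.inl j))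
      simp only [z, Sum.elim_inl] at this
      have h' : w (Sum.inl (Sum.inl j)) ≤ (x j : ℤ) := by exact_mod_cast this
      omega
    refine ⟨fun j => (w (Sum.inl (Sum.inl j))).toNat, ?_, hple, ?_, ?_, ?_⟩
    · intro h0
      apply h1
      have hz : ∀ j, w (Sum.inl (Sum.inl j)) = 0 := by
        intro j
        rw [← hcast j]
        exact_mod_cast congrFun h0 j
      ext ((j | k) | u)
      · exact hz j
      · rw [← hrow k]; simp [hz]
      · exact h2
    · intro j
      refine le_trans ?_ hsm
      have := h5 (Sum.inl (Sum.inl j))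
      exact Int.toNat_le.2 this
    · intro i
      simp only [hcast, hrow]
      exact h3 _
    · intro i
      have h7 := h4 (Sum.inl (Sum.inr i))
      simp only [z, Sum.elim_inl, Sum.elim_inr] at h7
      have h8 : w (Sum.inl (Sum.inr i)) ≤ y i := by exact_mod_cast h7
      have h9 : ∑ j, A i j * (((x j - (w (Sum.inl (Sum.inl j))).toNat : ℕ)) : ℤ)
          = ∑ j, A i j * (x j : ℤ) - w (Sum.inl (Sum.inr i)) := by
        rw [← hrow i, ← Finset.sum_sub_distrib]
        refine Finset.sum_congr rfl fun j _ => ?_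
        rw [Nat.cast_sub (hple j), hcast]
        ring
      simp only [Pi.sub_apply]
      rw [h9]
      simp only [y] at h8
      linarith

/-- Pottier's bound: the set of nonnegative solutions of `A·x ≥ c` is a finite
union of linear sets `L(bᵢ;Pᵢ)` whose base and period vectors have norm at most
`(n‖A‖ + ‖c‖ + 2)^(m+n)`. -/
theorem pottier_semilinear_bound (m n : ℕ) (A : Matrix (Fin m) (Fin n) ℤ)
    (c : Fin m → ℤ) :
    ∃ (I : Finset ℕ) (b : ℕ → (Fin n → ℕ)) (P : ℕ → Finset (Fin n → ℕ)),
      ({x : Fin n → ℕ | ∀ i : Fin m, c i ≤ ∑ j : Fin n, A i j * (x j : ℤ)} =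
        {x : Fin n → ℕ | ∃ i ∈ I, ∃ lam : (Fin n → ℕ) → ℕ,
          x = b i + ∑ p ∈ P i, lam p • p}) ∧
      (∀ i ∈ I, ∀ j : Fin n,
        b i j ≤ (n * (Finset.univ.sup fun i' : Fin m =>
              Finset.univ.sup fun j' : Fin n => (A i' j').natAbs) +
            (Finset.univ.sup fun i' : Fin m => (c i').natAbs) + 2) ^ (m + n)) ∧
      (∀ i ∈ I, ∀ p ∈ P i, ∀ j : Fin n,
        p j ≤ (n * (Finset.univ.sup fun i' : Fin m =>
              Finset.univ.sup fun j' : Fin n => (A i' j').natAbs) +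
            (Finset.univ.sup fun i' : Fin m => (c i').natAbs) + 2) ^ (m + n)) := by
  classical
  have hA : ∀ i j, |A i j| ≤ ((Finset.univ.sup fun i' : Fin m =>
              Finset.univ.sup fun j' : Fin n => (A i' j').natAbs : ℕ) : ℤ) := by
    intro i j
    rw [Int.abs_eq_natAbs]
    have h1 : (A i j).natAbs ≤ Finset.univ.sup fun j' : Fin n => (A i j').natAbs :=
      Finset.le_sup (f := fun j' : Fin n => (A i j').natAbs) (Finset.mem_univ j)
    have h2 := Finset.le_sup (f := fun i' : Fin m =>
              Finset.univ.sup fun j' : Fin n => (A i' j').natAbs) (Finset.mem_univ i)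
    exact_mod_cast h1.trans h2
  have hc : ∀ i, |c i| ≤ ((Finset.univ.sup fun i' : Fin m => (c i').natAbs : ℕ) : ℤ) := by
    intro i
    rw [Int.abs_eq_natAbs]
    exact_mod_cast Finset.le_sup (f := fun i' : Fin m => (c i').natAbs) (Finset.mem_univ i)
  have step := pot_step m n A c _ _ hA hc
  generalize (n * (Finset.univ.sup fun i' : Fin m =>
              Finset.univ.sup fun j' : Fin n => (A i' j').natAbs) +
            (Finset.univ.sup fun i' : Fin m => (c i').natAbs) + 2) ^ (m + n) = N at step ⊢
  let box : Finset (Fin n → ℕ) := Fintype.piFinset fun _ => Finset.range (N + 1)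
  have hbox : ∀ v : Fin n → ℕ, v ∈ box ↔ ∀ j, v j ≤ N := by
    intro v; simp [box, Nat.lt_succ_iff]
  let Bs := box.filter fun v => ∀ i, c i ≤ ∑ j, A i j * (v j : ℤ)
  let Ps := box.filter fun v => ∀ i, 0 ≤ ∑ j, A i j * (v j : ℤ)
  have hdec : ∀ v : Fin n → ℕ, (Encodable.decode (Encodable.encode v)).getD 0 = v := by
    intro v; simp
  refine ⟨Bs.image Encodable.encode, fun i => (Encodable.decode i).getD 0, fun _ => Ps,
    ?_, ?_, ?_⟩
  · ext x
    simp only [Set.mem_ofPred_eq, Finset.mem_image, exists_exists_and_eq_and, hdec]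
    constructor
    · have main : ∀ (d : ℕ) (x : Fin n → ℕ), ∑ j, x j ≤ d →
          (∀ i, c i ≤ ∑ j, A i j * (x j : ℤ)) →
          ∃ v ∈ Bs, ∃ lam : (Fin n → ℕ) → ℕ, x = v + ∑ p ∈ Ps, lam p • p := by
        intro d
        induction d with
        | zero =>
          intro x hd hx
          refine ⟨x, Finset.mem_filter.2 ⟨(hbox x).2 ?_, hx⟩, 0, by simp⟩
          intro j
          have := Finset.single_le_sum (f := x) (fun _ _ => Nat.zero_le _) (Finset.mem_univ j)
          omega
        | succ d ih =>
          intro x hd hx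
          rcases step x hx with h | ⟨p, hp0, hpx, hpN, hpA, hxp⟩
          · exact ⟨x, Finset.mem_filter.2 ⟨(hbox x).2 h, hx⟩, 0, by simp⟩
          · have hsum : ∑ j, (x - p) j + ∑ j, p j = ∑ j, x j := by
              rw [← Finset.sum_add_distrib]
              exact Finset.sum_congr rfl fun j _ => Nat.sub_add_cancel (hpx j)
            have hppos : 0 < ∑ j, p j := by
              obtain ⟨j, hj⟩ := Function.ne_iff.1 hp0
              exact Finset.sum_pos' (fun _ _ => Nat.zero_le _)
                ⟨j, Finset.mem_univ _, Nat.pos_of_ne_zero hj⟩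
            obtain ⟨v, hv, lam, hl⟩ := ih (x - p) (by omega) hxp
            have hpP : p ∈ Ps := Finset.mem_filter.2 ⟨(hbox p).2 hpN, hpA⟩
            refine ⟨v, hv, lam + Pi.single p 1, ?_⟩
            have hsplit : ∑ q ∈ Ps, (lam + Pi.single p 1 : (Fin n → ℕ) → ℕ) q • q
                = ∑ q ∈ Ps, lam q • q + p := by
              simp only [Pi.add_apply, add_smul, Finset.sum_add_distrib]
              congr 1
              rw [Finset.sum_eq_single_of_mem p hpP]
              · simp
              · intro q _ hq; simp [hq]
            rw [hsplit, ← add_assoc, ← hl]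
            exact (tsub_add_cancel_of_le hpx).symm
      exact main _ x le_rfl
    · rintro ⟨v, hv, lam, rfl⟩ i
      have h1 := (Finset.mem_filter.1 hv).2 i
      have h2 : 0 ≤ ∑ j, A i j * ((∑ p ∈ Ps, lam p • p : Fin n → ℕ) j : ℤ) := by
        have : ∑ j, A i j * ((∑ p ∈ Ps, lam p • p : Fin n → ℕ) j : ℤ)
            = ∑ p ∈ Ps, (lam p : ℤ) * ∑ j, A i j * (p j : ℤ) := by
          simp only [Finset.sum_apply, Pi.smul_apply, smul_eq_mul, Nat.cast_sum, Nat.cast_mul,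
            Finset.mul_sum]
          rw [Finset.sum_comm]
          refine Finset.sum_congr rfl fun p _ => Finset.sum_congr rfl fun j _ => by ring
        rw [this]
        exact Finset.sum_nonneg fun p hp =>
          mul_nonneg (by positivity) ((Finset.mem_filter.1 hp).2 i)
      simp only [Pi.add_apply, Nat.cast_add, mul_add, Finset.sum_add_distrib]
      linarith
  · intro i hi j
    obtain ⟨v, hv, rfl⟩ := Finset.mem_image.1 hi
    simp only [hdec]
    exact (hbox v).1 (Finset.mem_filter.1 hv).1 j
  · intro i _ p hp j
    exact (hbox p).1 (Finset.mem_filter.1 hp).1 j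
end

section
/- Let A be an m × n integer matrix and c ∈ ℤᵐ. If the set {x ∈ ℕⁿ : A·x ≥ c (componentwise)} is nonempty, then it contains a solution x with ‖x‖ ≤ (n‖A‖ + ‖c‖ + 2)^{m+n}. -/
theorem ssb_range (n : ℕ) (a : Fin n → ℤ) (c s : ℤ) (x : Fin n → ℤ) (N k : ℤ) (α γ : ℤ)
    (hN : 0 < N) (hk0 : 0 ≤ k) (hk : k < N)
    (hs : s = ∑ j, a j * x j - c) (ha : ∀ j, |a j| ≤ α) (hc : |c| ≤ γ) :
    (∑ j, a j * (k * x j / N) - k * s / N) ∈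
      Finset.Ico (min c 0 - ∑ j, max (a j) 0)
        (min c 0 - ∑ j, max (a j) 0 + (n * α + γ + 2)) := by
  have key : N * (∑ j, a j * (k * x j / N) - k * s / N)
      = k * c - ∑ j, a j * (k * x j % N) + k * s % N := by
    have h1 : ∀ j, N * (a j * (k * x j / N)) = k * (a j * x j) - a j * (k * x j % N) := by
      intro j
      have := Int.mul_ediv_add_emod (k * x j) N
      linear_combination a j * this
    have h2 := Int.mul_ediv_add_emod (k * s) N
    rw [mul_sub, Finset.mul_sum, Finset.sum_congr rfl (fun j _ => h1 j),
      Finset.sum_sub_distrib, ← Finset.mul_sum]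
    have h3 : ∑ j, a j * x j = s + c := by rw [hs]; ring
    rw [h3]
    linear_combination -h2
  have hr0 : ∀ y : ℤ, 0 ≤ y % N := fun y => Int.emod_nonneg _ hN.ne'
  have hr1 : ∀ y : ℤ, y % N < N := fun y => Int.emod_lt_of_pos _ hN
  have hU : ∑ j, a j * (k * x j % N) ≤ N * ∑ j, max (a j) 0 := by
    rw [Finset.mul_sum]
    refine Finset.sum_le_sum fun j _ => ?_
    have h0 := hr0 (k * x j)
    have h1 := hr1 (k * x j)
    calc a j * (k * x j % N) ≤ max (a j) 0 * (k * x j % N) :=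
          mul_le_mul_of_nonneg_right (le_max_left _ _) h0
      _ ≤ max (a j) 0 * N := mul_le_mul_of_nonneg_left h1.le (le_max_right _ _)
      _ = _ := mul_comm _ _
  have hL : -(N * ∑ j, max (-a j) 0) ≤ ∑ j, a j * (k * x j % N) := by
    rw [Finset.mul_sum, ← Finset.sum_neg_distrib]
    refine Finset.sum_le_sum fun j _ => ?_
    have h0 := hr0 (k * x j)
    have h1 := hr1 (k * x j)
    have : (-a j) * (k * x j % N) ≤ N * max (-a j) 0 := by
      calc (-a j) * (k * x j % N) ≤ max (-a j) 0 * (k * x j % N) :=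
            mul_le_mul_of_nonneg_right (le_max_left _ _) h0
        _ ≤ max (-a j) 0 * N := mul_le_mul_of_nonneg_left h1.le (le_max_right _ _)
        _ = _ := mul_comm _ _
    linarith
  have hsum : ∑ j, max (a j) 0 + ∑ j, max (-a j) 0 ≤ n * α := by
    rw [← Finset.sum_add_distrib]
    calc _ ≤ ∑ _j : Fin n, α := Finset.sum_le_sum fun j _ => by
            have := ha j
            rw [abs_le] at this
            omega
      _ = _ := by simp
  have hc1 : N * min c 0 ≤ k * c := by
    rcases le_total c 0 with h | h
    · rw [min_eq_left h]; nlinarith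
    · rw [min_eq_right h]; nlinarith
  have hc2 : k * c ≤ N * max c 0 := by
    rcases le_total c 0 with h | h
    · rw [max_eq_right h]; nlinarith
    · rw [max_eq_left h]; nlinarith
  have hc3 : max c 0 - min c 0 ≤ γ := by
    rw [abs_le] at hc
    omega
  have q0 := hr0 (k * s)
  have q1 := hr1 (k * s)
  rw [Finset.mem_Ico]
  constructor
  · refine le_of_mul_le_mul_left (a := N) ?_ hN
    rw [key, mul_sub]; linarith
  · have : (∑ j, a j * (k * x j / N) - k * s / N) < max c 0 + ∑ j, max (-a j) 0 + 1 := by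
      refine lt_of_mul_lt_mul_left (a := N) ?_ hN.le
      rw [key, mul_add, mul_add]; linarith
    linarith


/-- Small-solution bound: if `A·x ≥ c` has a nonnegative solution, it has one
of norm at most `(n‖A‖ + ‖c‖ + 2)^(m+n)`. -/
theorem small_solution_bound (m n : ℕ) (A : Matrix (Fin m) (Fin n) ℤ)
    (c : Fin m → ℤ)
    (hne : ∃ x : Fin n → ℕ, ∀ i : Fin m, c i ≤ ∑ j : Fin n, A i j * (x j : ℤ)) :
    ∃ x : Fin n → ℕ, (∀ i : Fin m, c i ≤ ∑ j : Fin n, A i j * (x j : ℤ)) ∧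
      ∀ j : Fin n,
        x j ≤ (n * (Finset.univ.sup fun i' : Fin m =>
              Finset.univ.sup fun j' : Fin n => (A i' j').natAbs) +
            (Finset.univ.sup fun i' : Fin m => (c i').natAbs) + 2) ^ (m + n) := by
  obtain ⟨x, hx, hmin⟩ := WellFounded.has_min (measure fun x : Fin n → ℕ => ∑ j, x j).wf
    {x : Fin n → ℕ | ∀ i : Fin m, c i ≤ ∑ j : Fin n, A i j * (x j : ℤ)} hne
  refine ⟨x, hx, ?_⟩
  set α := Finset.univ.sup fun i' : Fin m => Finset.univ.sup fun j' : Fin n => (A i' j').natAbs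
    with hα
  set γ := Finset.univ.sup fun i' : Fin m => (c i').natAbs with hγ
  intro j₀
  by_contra! hlt
  have hA : ∀ i j, |A i j| ≤ (α : ℤ) := by
    intro i j
    rw [Int.abs_eq_natAbs]
    have h1 := Finset.le_sup (f := fun j' : Fin n => (A i j').natAbs) (Finset.mem_univ j)
    have h2 := Finset.le_sup (f := fun i' : Fin m =>
      Finset.univ.sup fun j' : Fin n => (A i' j').natAbs) (Finset.mem_univ i)
    exact_mod_cast h1.trans h2
  have hC : ∀ i, |c i| ≤ (γ : ℤ) := by
    intro i
    rw [Int.abs_eq_natAbs]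
    exact_mod_cast Finset.le_sup (f := fun i' : Fin m => (c i').natAbs) (Finset.mem_univ i)
  set B := n * α + γ + 2 with hB
  have hBm : B ^ m < x j₀ :=
    lt_of_le_of_lt (Nat.pow_le_pow_right (by omega) (Nat.le_add_right m n)) hlt
  set N := x j₀ with hNdef
  have hN : 0 < N := by omega
  have hNz : (0 : ℤ) < N := by exact_mod_cast hN
  let s : Fin m → ℤ := fun i => ∑ j, A i j * (x j : ℤ) - c i
  have hs0 : ∀ i, 0 ≤ s i := fun i => sub_nonneg.2 (hx i)
  let f : ℕ → Fin m → ℤ := fun k i =>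
    ∑ j, A i j * ((k : ℤ) * (x j : ℤ) / (N : ℤ)) - (k : ℤ) * s i / (N : ℤ)
  let L : Fin m → ℤ := fun i => min (c i) 0 - ∑ j, max (A i j) 0
  obtain ⟨k, hk, l, hl, hkl, hf⟩ := Finset.exists_ne_map_eq_of_card_lt_of_maps_to
    (s := Finset.range N)
    (t := Fintype.piFinset fun i => Finset.Ico (L i) (L i + ((n : ℤ) * α + γ + 2)))
    (f := f) (by
      rw [Fintype.card_piFinset]
      have : ((n : ℤ) * α + γ + 2).toNat = B := by
        rw [hB]; omega
      simpa [this] using hBm) (by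
      intro k hk
      have hk' : k < N := by simpa using hk
      simp only [Finset.mem_coe, Fintype.mem_piFinset]
      intro i
      exact ssb_range n (A i) (c i) (s i) (fun j => (x j : ℤ)) N k α γ hNz (by positivity)
        (by exact_mod_cast hk') rfl (hA i) (hC i))
  have main : ∀ k l : ℕ, k < l → l < N → f k = f l → False := by
    intro k l hkl hl hf
    let d : Fin n → ℕ := fun j => l * x j / N - k * x j / N
    have hmono : ∀ j, k * x j / N ≤ l * x j / N := fun j =>
      Nat.div_le_div_right (Nat.mul_le_mul_right _ hkl.le)
    have hle : ∀ j, l * x j / N ≤ x j := fun j =>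
      Nat.div_le_of_le_mul (Nat.mul_le_mul_right _ hl.le)
    have hd : ∀ j, d j ≤ x j := fun j => (Nat.sub_le _ _).trans (hle j)
    have hdz : ∀ j, (d j : ℤ) = (l : ℤ) * x j / N - (k : ℤ) * x j / N := by
      intro j
      simp only [d]
      rw [Nat.cast_sub (hmono j)]
      push_cast
      rfl
    have hd0 : 0 < d j₀ := by
      simp only [d]
      rw [← hNdef, Nat.mul_div_cancel _ hN, Nat.mul_div_cancel _ hN]
      omega
    refine hmin (fun j => x j - d j) ?_ ?_
    · intro i
      have h1 : ∑ j, A i j * ((x j - d j : ℕ) : ℤ)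
          = ∑ j, A i j * (x j : ℤ) - ((l : ℤ) * s i / N - (k : ℤ) * s i / N) := by
        have h2 := congrFun hf i
        simp only [f] at h2
        have h3 : ∀ j, A i j * ((x j - d j : ℕ) : ℤ) = A i j * (x j : ℤ)
            - A i j * ((l : ℤ) * x j / N) + A i j * ((k : ℤ) * x j / N) := by
          intro j
          rw [Nat.cast_sub (hd j), hdz j]; ring
        rw [Finset.sum_congr rfl (fun j _ => h3 j), Finset.sum_add_distrib,
          Finset.sum_sub_distrib]
        linarith
      have h4 : (l : ℤ) * s i / N ≤ s i := by
        refine Int.ediv_le_of_le_mul hNz ?_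
        have : (l : ℤ) ≤ N := by exact_mod_cast hl.le
        nlinarith [hs0 i]
      have h5 : 0 ≤ (k : ℤ) * s i / N :=
        Int.ediv_nonneg (mul_nonneg (by positivity) (hs0 i)) hNz.le
      have h6 : s i = ∑ j, A i j * (x j : ℤ) - c i := rfl
      rw [h1]; linarith
    · change ∑ j, (x j - d j) < ∑ j, x j
      exact Finset.sum_lt_sum (fun j _ => Nat.sub_le _ _) ⟨j₀, Finset.mem_univ _, by omega⟩
  rw [Finset.mem_range] at hk hl
  rcases lt_or_gt_of_ne hkl with h | h
  · exact main k l h hl hf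
  · exact main l k h hk hf.symm
end

section
/- Let b ∈ ℕ, let k ≥ 1, let p₁,…,p_k be positive integers with g = gcd(p₁,…,p_k) and P = max{p₁,…,p_k}, and let M = {b + λ₁p₁ + ⋯ + λ_k p_k : λ₁,…,λ_k ∈ ℕ}. Then for every natural number a ≥ b + P², we have a ∈ M if and only if g divides a − b. Consequently, M is an ultimately periodic set with threshold at most b + P² and period at most P. -/
theorem lsp_short_list (m : ℕ) (hm : 0 < m) (s : Set ℕ) (n : ℕ) :
    ∀ (N : ℕ) (l : List ℕ), l.length = N → (∀ y ∈ l, y ∈ s) → l.sum ≡ n [MOD m] →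
      ∃ l' : List ℕ, l'.length ≤ m ∧ (∀ y ∈ l', y ∈ s) ∧ l'.sum ≡ n [MOD m] := by
  intro N
  induction N using Nat.strong_induction_on with
  | _ N ih =>
    intro l hl hs hn
    by_cases hlm : l.length ≤ m
    · exact ⟨l, hlm, hs, hn⟩
    push Not at hlm
    obtain ⟨i, hi, j, hj, hij, he⟩ := Finset.exists_ne_map_eq_of_card_lt_of_maps_to
      (s := Finset.range (m + 1)) (t := Finset.range m)
      (f := fun i => (l.take i).sum % m) (by simp)
      (fun i _ => by simpa using Nat.mod_lt _ hm)
    have key : ∀ i j : ℕ, i < j → j ≤ m → (l.take i).sum % m = (l.take j).sum % m →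
        ∃ l' : List ℕ, l'.length ≤ m ∧ (∀ y ∈ l', y ∈ s) ∧ l'.sum ≡ n [MOD m] := by
      intro i j hij hj he
      refine ih _ ?_ (l.take i ++ l.drop j) rfl ?_ ?_
      · simp only [List.length_append, List.length_take, List.length_drop]
        omega
      · intro y hy
        rcases List.mem_append.1 hy with h | h
        · exact hs y (List.mem_of_mem_take h)
        · exact hs y (List.mem_of_mem_drop h)
      · rw [List.sum_append]
        refine Nat.ModEq.trans (Nat.ModEq.add_right _ he) ?_
        rwa [List.sum_take_add_sum_drop]
    simp only [Finset.mem_range] at hi hj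
    rcases lt_or_gt_of_ne hij with h | h
    · exact key i j h (by omega) he
    · exact key j i h (by omega) he.symm

theorem lsp_mem_closure {k : ℕ} (p : Fin k → ℕ) (n : ℕ) :
    n ∈ AddSubmonoid.closure (Set.range p) ↔ ∃ lam : Fin k → ℕ, n = ∑ i, lam i * p i := by
  rw [← Submodule.span_nat_eq_addSubmonoidClosure, Submodule.mem_toAddSubmonoid,
    Submodule.mem_span_range_iff_exists_fun]
  simp [eq_comm]

theorem lsp_main {k : ℕ} (p : Fin k → ℕ) (hp : ∀ i, 0 < p i) (i₀ : Fin k) (n : ℕ)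
    (hn : (Finset.univ.sup p) ^ 2 ≤ n) (hg : Finset.univ.gcd p ∣ n) :
    n ∈ AddSubmonoid.closure (Set.range p) := by
  have hle : ∀ i, p i ≤ Finset.univ.sup p := fun i => Finset.le_sup (Finset.mem_univ i)
  have hg' : Nat.setGcd (Set.range p) ∣ n :=
    dvd_trans (Finset.dvd_gcd fun i _ => Nat.setGcd_dvd_of_mem (Set.mem_range_self i)) hg
  obtain ⟨N, hN⟩ := Nat.exists_mem_closure_of_ge (Set.range p)
  have h1 := hN (n + N * p i₀) (by nlinarith [hp i₀])
    (dvd_add hg' (dvd_mul_of_dvd_right (Nat.setGcd_dvd_of_mem (Set.mem_range_self i₀)) _))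
  obtain ⟨l, hl, hs⟩ := AddSubmonoid.exists_list_of_mem_closure h1
  obtain ⟨l', hlen, hl', hs'⟩ := lsp_short_list (p i₀) (hp i₀) (Set.range p) n _ l rfl hl
    (by rw [hs]; simp [Nat.ModEq])
  have hb : l'.sum ≤ n := by
    have := List.sum_le_card_nsmul l' (Finset.univ.sup p) (fun y hy => by
      obtain ⟨i, rfl⟩ := hl' y hy
      exact hle i)
    rw [smul_eq_mul] at this
    have h2 := hle i₀
    nlinarith
  obtain ⟨c, hc⟩ := (Nat.modEq_iff_dvd' hb).1 hs'
  have : n = l'.sum + c • p i₀ := by rw [smul_eq_mul, mul_comm]; omega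
  rw [this]
  exact add_mem (AddSubmonoid.list_sum_mem _ fun y hy => AddSubmonoid.subset_closure (hl' y hy))
    (nsmul_mem (AddSubmonoid.subset_closure (Set.mem_range_self i₀)) c)

/-- Projection of a linear set onto one coordinate: above `b + P²`, membership
in `M = {b + Σ λᵢpᵢ}` is equivalent to divisibility of `a - b` by
`g = gcd(p₁,…,p_k)`; consequently `M` is ultimately periodic with threshold at
most `b + P²` and period at most `P = max pᵢ`. -/
theorem linear_set_projection_ultimately_periodic (b k : ℕ) (hk : 1 ≤ k)
    (p : Fin k → ℕ) (hp : ∀ i, 0 < p i) :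
    (∀ a : ℕ, b + (Finset.univ.sup p) ^ 2 ≤ a →
      ((∃ lam : Fin k → ℕ, a = b + ∑ i, lam i * p i) ↔
        Finset.univ.gcd p ∣ a - b)) ∧
    ∃ q : ℕ, 0 < q ∧ q ≤ Finset.univ.sup p ∧
      ∀ a : ℕ, b + (Finset.univ.sup p) ^ 2 ≤ a →
        ((∃ lam : Fin k → ℕ, a = b + ∑ i, lam i * p i) ↔
          (∃ lam : Fin k → ℕ, a + q = b + ∑ i, lam i * p i)) := by
  have main : ∀ a : ℕ, b + (Finset.univ.sup p) ^ 2 ≤ a →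
      ((∃ lam : Fin k → ℕ, a = b + ∑ i, lam i * p i) ↔
        Finset.univ.gcd p ∣ a - b) := by
    intro a ha
    constructor
    · rintro ⟨lam, rfl⟩
      rw [Nat.add_sub_cancel_left]
      exact Finset.dvd_sum fun i hi => dvd_mul_of_dvd_right (Finset.gcd_dvd hi) _
    · intro h
      obtain ⟨lam, hlam⟩ := (lsp_mem_closure p _).1 (lsp_main p hp ⟨0, hk⟩ (a - b) (by omega) h)
      exact ⟨lam, by omega⟩
  refine ⟨main, p ⟨0, hk⟩, hp _, Finset.le_sup (Finset.mem_univ _), fun a ha => ?_⟩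
  rw [main a ha, main _ (le_trans ha (Nat.le_add_right _ _)), Nat.sub_add_comm (by omega)]
  exact (Nat.dvd_add_left (Finset.gcd_dvd (Finset.mem_univ _))).symm
end

section
/- For n ≥ 1, let N_n = {a ∈ ℕ : there exists m with 1 < m < 2^n and m divides a}. Suppose p > 0 and t ∈ ℕ are such that for all a ≥ t, a ∈ N_n if and only if a + p ∈ N_n. Then every prime q < 2^n divides p; in particular, p ≥ ∏_{q prime, q < 2^n} q. -/
/-- Every eventual period of `N_n = {a : ∃ m, 1 < m < 2^n, m ∣ a}` is divisible
by every prime below `2^n`, hence is at least the product of all such primes. -/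
theorem eventual_period_divisible_by_primes (n : ℕ) (hn : 1 ≤ n) (p t : ℕ)
    (hp : 0 < p)
    (hper : ∀ a : ℕ, t ≤ a →
      ((∃ m : ℕ, 1 < m ∧ m < 2 ^ n ∧ m ∣ a) ↔
        (∃ m : ℕ, 1 < m ∧ m < 2 ^ n ∧ m ∣ a + p))) :
    (∀ q : ℕ, Nat.Prime q → q < 2 ^ n → q ∣ p) ∧
    (∏ q ∈ Finset.filter Nat.Prime (Finset.range (2 ^ n)), q) ≤ p := by
  have key : ∀ q : ℕ, Nat.Prime q → q < 2 ^ n → q ∣ p := by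
    intro q hq hqn
    by_contra hqp
    set Q := ∏ r ∈ (Finset.filter Nat.Prime (Finset.range (2 ^ n))).erase q, r with hQ
    have co : Nat.Coprime Q q := by
      apply Nat.Coprime.prod_left
      intro r hr
      simp only [Finset.mem_erase, Finset.mem_filter] at hr
      exact (Nat.coprime_primes hr.2.2 hq).2 hr.1
    have hQpos : 0 < Q := by
      apply Finset.prod_pos
      intro r hr
      simp only [Finset.mem_erase, Finset.mem_filter] at hr
      exact hr.2.2.pos
    obtain ⟨k, hk1, hk2⟩ := Nat.chineseRemainder co 1 p
    have hle : t + p ≤ k + (t + p) * (Q * q) := by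
      have := Nat.le_mul_of_pos_right (t + p) (Nat.mul_pos hQpos hq.pos)
      omega
    obtain ⟨b, hb⟩ : ∃ b, b = k + (t + p) * (Q * q) := ⟨_, rfl⟩
    rw [← hb] at hle
    have hb1 : b ≡ 1 [MOD Q] := by
      have h0 : (t + p) * (Q * q) ≡ 0 [MOD Q] :=
        (Nat.modEq_zero_iff_dvd).2 ⟨(t + p) * q, by ring⟩
      rw [hb]
      exact hk1.add h0
    have hb2 : b ≡ p [MOD q] := by
      have h0 : (t + p) * (Q * q) ≡ 0 [MOD q] :=
        (Nat.modEq_zero_iff_dvd).2 ⟨(t + p) * Q, by ring⟩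
      rw [hb]
      exact hk2.add h0
    have hqa : q ∣ b - p := (Nat.modEq_iff_dvd' (by omega)).1 hb2.symm
    obtain ⟨m, hm1, hmn, hmd⟩ := (hper (b - p) (by omega)).1 ⟨q, hq.one_lt, hqn, hqa⟩
    rw [Nat.sub_add_cancel (by omega)] at hmd
    have hr : (m.minFac).Prime := Nat.minFac_prime (by omega)
    have hrb : m.minFac ∣ b := (Nat.minFac_dvd m).trans hmd
    have hrn : m.minFac < 2 ^ n := (Nat.minFac_le (by omega)).trans_lt hmn
    by_cases h : m.minFac = q
    · rw [h] at hrb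
      exact hqp ((hb2.dvd_iff dvd_rfl).1 hrb)
    · have hrQ : m.minFac ∣ Q := by
        apply Finset.dvd_prod_of_mem (fun r => r)
        simp [h, hr, hrn]
      exact hr.one_lt.ne' (Nat.dvd_one.1 ((hb1.dvd_iff hrQ).1 hrb))
  refine ⟨key, Nat.le_of_dvd hp ?_⟩
  apply Finset.prod_primes_dvd
  · intro r hr
    exact (Finset.mem_filter.1 hr).2.prime
  · intro r hr
    rw [Finset.mem_filter, Finset.mem_range] at hr
    exact key r hr.2 hr.1
end

section
/- Let A be an m × (n+1) integer matrix, c ∈ ℤᵐ, and set K = ((n+1)·‖A‖ + ‖c‖ + 2)^{m+n+1}. Let N = {a ∈ ℕ : there exists x ∈ ℕⁿ such that A·(a,x) ≥ c (componentwise)} be the projection of the solution set onto the first coordinate. Then there exist t ∈ ℕ with t ≤ K + K² and p ∈ ℕ with 0 < p and p dividing lcm{1,…,K}, such that for all a ≥ t, a ∈ N if and only if a + p ∈ N. -/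
lemma pigeon_small {d : ℕ} {β : Type*} [Fintype β] (M : β → Fin d → ℤ) (R : ℕ) (hR : 1 ≤ R)
    (hM : ∀ b, ∑ j, |M b j| ≤ R) (hc : Fintype.card β < d) :
    ∃ g : Fin d → ℤ, g ≠ 0 ∧ (∀ b, ∑ j, M b j * g j = 0) ∧ ∀ j, |g j| ≤ (R : ℤ) ^ (d - 1) := by
  classical
  set B : ℕ := R ^ (d - 1) with hB
  let s : Finset (Fin d → ℕ) := Fintype.piFinset fun _ => Finset.range (B + 1)
  let lo : β → ℤ := fun b => ∑ j, min (M b j) 0 * B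
  let hi : β → ℤ := fun b => ∑ j, max (M b j) 0 * B
  let t : Finset (β → ℤ) := Fintype.piFinset fun b => Finset.Icc (lo b) (hi b)
  let f : (Fin d → ℕ) → β → ℤ := fun x b => ∑ j, M b j * (x j : ℤ)
  have hmap : ∀ x ∈ s, f x ∈ t := by
    intro x hx
    simp only [s, Fintype.mem_piFinset, Finset.mem_range] at hx
    simp only [t, Fintype.mem_piFinset, Finset.mem_Icc]
    intro b
    constructor
    · apply Finset.sum_le_sum
      intro j _
      have h1 : (x j : ℤ) ≤ B := by have := hx j; omega
      have h2 : (0 : ℤ) ≤ x j := by positivity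
      rcases le_total (M b j) 0 with h | h
      · rw [min_eq_left h]; nlinarith
      · rw [min_eq_right h]; nlinarith
    · apply Finset.sum_le_sum
      intro j _
      have h1 : (x j : ℤ) ≤ B := by have := hx j; omega
      have h2 : (0 : ℤ) ≤ x j := by positivity
      rcases le_total (M b j) 0 with h | h
      · rw [max_eq_right h]; nlinarith
      · rw [max_eq_left h]; nlinarith
  have hcard : t.card < s.card := by
    have hs : s.card = (B + 1) ^ d := by simp [s]
    have hle : t.card ≤ (B * R + 1) ^ Fintype.card β := by
      simp only [t, Fintype.card_piFinset]
      apply Finset.prod_le_pow_card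
      intro b _
      rw [Int.card_Icc]
      have h : hi b - lo b = (∑ j, |M b j|) * B := by
        simp only [hi, lo]
        rw [← Finset.sum_sub_distrib, Finset.sum_mul]
        apply Finset.sum_congr rfl
        intro j _
        rw [← sub_mul]
        congr 1
        rcases le_total (M b j) 0 with h | h
        · rw [max_eq_right h, min_eq_left h, abs_of_nonpos h]; ring
        · rw [max_eq_left h, min_eq_right h, abs_of_nonneg h]; ring
      have h2 : (∑ j, |M b j|) * (B : ℤ) ≤ R * B := by
        have := hM b
        gcongr
      have h3 : ((B * R + 1 : ℕ) : ℤ) = R * B + 1 := by push_cast; ring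
      omega
    rw [hs]
    obtain ⟨e, rfl⟩ : ∃ e, d = e + 1 := ⟨d - 1, by omega⟩
    calc t.card ≤ (B * R + 1) ^ Fintype.card β := hle
      _ ≤ (B * R + 1) ^ e := Nat.pow_le_pow_right (by omega) (by omega)
      _ ≤ ((B + 1) * R) ^ e := by gcongr; nlinarith
      _ = (B + 1) ^ e * B := by rw [mul_pow, hB]; simp
      _ < (B + 1) ^ e * (B + 1) := by
          apply Nat.mul_lt_mul_of_pos_left (by omega) (by positivity)
      _ = _ := by ring
  obtain ⟨x, hx, y, hy, hne, hxy⟩ := Finset.exists_ne_map_eq_of_card_lt_of_maps_to hcard hmap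
  simp only [s, Fintype.mem_piFinset, Finset.mem_range] at hx hy
  refine ⟨fun j => (x j : ℤ) - y j, ?_, ?_, ?_⟩
  · intro h
    apply hne
    ext j
    have := congrFun h j
    simp at this
    omega
  · intro b
    have := congrFun hxy b
    simp only [f] at this
    simp only [mul_sub, Finset.sum_sub_distrib, this, sub_self]
  · intro j
    have h1 := hx j
    have h2 := hy j
    have : ((R : ℤ) ^ (d - 1)) = (B : ℤ) := by simp [hB]
    rw [this, abs_le]
    constructor <;> dsimp only <;> omega

/-- evaluation of an integer form -/
def evF {d : ℕ} (l : Fin d → ℤ) (u : Fin d → ℚ) : ℚ := ∑ j, (l j : ℚ) * u j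

lemma evF_add {d : ℕ} (l : Fin d → ℤ) (u v : Fin d → ℚ) : evF l (u + v) = evF l u + evF l v := by
  simp [evF, mul_add, Finset.sum_add_distrib]

lemma evF_sub {d : ℕ} (l : Fin d → ℤ) (u v : Fin d → ℚ) : evF l (u - v) = evF l u - evF l v := by
  simp [evF, mul_sub, Finset.sum_sub_distrib]

lemma evF_smul {d : ℕ} (l : Fin d → ℤ) (t : ℚ) (u : Fin d → ℚ) : evF l (t • u) = t * evF l u := by
  simp only [evF, Finset.mul_sum, Pi.smul_apply, smul_eq_mul]
  exact Finset.sum_congr rfl fun j _ => by ring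

lemma kernel_small {d : ℕ} {ι : Type*} [Finite ι] (L : ι → Fin d → ℤ) (R : ℕ) (hR : 1 ≤ R)
    (hL : ∀ i, ∑ j, |L i j| ≤ R) (u : Fin d → ℚ) (hu : u ≠ 0) :
    ∃ g : Fin d → ℤ, g ≠ 0 ∧ (∀ i, evF (L i) u = 0 → evF (L i) (fun j => (g j : ℚ)) = 0) ∧
      ∀ j, |g j| ≤ (R : ℤ) ^ (d - 1) := by
  classical
  let row : ι → Fin d → ℚ := fun i j => (L i j : ℚ)
  let s : Set (Fin d → ℚ) := row '' {i | evF (L i) u = 0}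
  have hsfin : s.Finite := Set.toFinite _
  obtain ⟨b, hbs, hspan, hli⟩ := exists_linearIndependent ℚ s
  have hbfin : b.Finite := hsfin.subset hbs
  let _ : Fintype b := hbfin.fintype
  let ker : (Fin d → ℚ) → Submodule ℚ (Fin d → ℚ) := fun w =>
    LinearMap.ker (∑ j, (w j) • (LinearMap.proj j : (Fin d → ℚ) →ₗ[ℚ] ℚ))
  have hker : ∀ w r, r ∈ ker w ↔ ∑ j, r j * w j = 0 := by
    intro w r
    simp [ker, LinearMap.mem_ker, LinearMap.sum_apply, mul_comm]
  have hsu : Submodule.span ℚ s ≤ ker u := by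
    rw [Submodule.span_le]
    rintro _ ⟨i, hi, rfl⟩
    exact (hker _ _).2 hi
  have hcard : Fintype.card b < d := by
    have h1 : Module.finrank ℚ (Submodule.span ℚ b) = Fintype.card b := by
      rw [finrank_span_set_eq_card hli, Set.toFinset_card]
    have h2 : Submodule.span ℚ b < ⊤ := by
      rw [lt_top_iff_ne_top, hspan]
      intro h
      apply hu
      ext j
      have : Pi.single j (1 : ℚ) ∈ ker u := hsu (h ▸ Submodule.mem_top)
      rw [hker] at this
      simpa [Pi.single_apply] using this
    have := Submodule.finrank_lt h2.ne
    rw [h1] at this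
    simpa using this
  have hch : ∀ x : b, ∃ i, evF (L i) u = 0 ∧ row i = x := fun x => hbs x.2
  choose idx hidx hidx' using hch
  obtain ⟨g, hg0, hg, hgb⟩ := pigeon_small (fun x : b => L (idx x)) R hR (fun x => hL _) hcard
  refine ⟨g, hg0, ?_, hgb⟩
  have hsg : Submodule.span ℚ s ≤ ker (fun j => (g j : ℚ)) := by
    rw [← hspan, Submodule.span_le]
    intro x hx
    refine (hker _ _).2 ?_
    have := hg ⟨x, hx⟩
    have h2 := hidx' ⟨x, hx⟩
    simp only at h2
    rw [← h2]
    simp only [row]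
    exact_mod_cast this
  intro i hi
  exact (hker _ _).1 (hsg (Submodule.subset_span ⟨i, hi, rfl⟩))

/-- moving in direction `-g` until a new constraint is tight -/
lemma move_tight {d : ℕ} {ι : Type*} [Fintype ι] (L : ι → Fin d → ℤ) (u g : Fin d → ℚ)
    (hu : ∀ i, 0 ≤ evF (L i) u) (hg : ∀ i, evF (L i) u = 0 → evF (L i) g = 0)
    (hpos : ∃ i, 0 < evF (L i) g) :
    ∃ t : ℚ, 0 ≤ t ∧ (∀ i, 0 ≤ evF (L i) (u - t • g)) ∧
      (∀ i, evF (L i) u = 0 → evF (L i) (u - t • g) = 0) ∧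
      ∃ i, evF (L i) u ≠ 0 ∧ evF (L i) (u - t • g) = 0 := by
  classical
  obtain ⟨i0, hi0⟩ := hpos
  obtain ⟨k, hk, hmin⟩ := Finset.exists_min_image
    (Finset.univ.filter fun i => 0 < evF (L i) g) (fun i => evF (L i) u / evF (L i) g)
    ⟨i0, by simp [hi0]⟩
  simp only [Finset.mem_filter, Finset.mem_univ, true_and] at hk hmin
  have ht0 : 0 ≤ evF (L k) u / evF (L k) g := div_nonneg (hu k) hk.le
  refine ⟨evF (L k) u / evF (L k) g, ht0, ?_, ?_, k, ?_, ?_⟩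
  · intro i
    rw [evF_sub, evF_smul]
    rcases lt_or_ge 0 (evF (L i) g) with h | h
    · have := hmin i h
      rw [le_div_iff₀ h] at this
      linarith
    · have := hu i
      nlinarith
  · intro i hi
    rw [evF_sub, evF_smul, hi, hg i hi]; simp
  · intro h
    have := hg k h
    linarith
  · rw [evF_sub, evF_smul, div_mul_cancel₀ _ hk.ne', sub_self]

open Classical in
noncomputable def nt {d : ℕ} {ι : Type*} [Fintype ι] (L : ι → Fin d → ℤ) (u : Fin d → ℚ) : ℕ :=
  (Finset.univ.filter fun i => evF (L i) u ≠ 0).card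

lemma nt_lt {d : ℕ} {ι : Type*} [Fintype ι] (L : ι → Fin d → ℤ) (u w : Fin d → ℚ)
    (h1 : ∀ i, evF (L i) u = 0 → evF (L i) w = 0)
    (h2 : ∃ i, evF (L i) u ≠ 0 ∧ evF (L i) w = 0) : nt L w < nt L u := by
  classical
  unfold nt
  apply Finset.card_lt_card
  rw [Finset.ssubset_iff_of_subset]
  · obtain ⟨i, hi, hi'⟩ := h2
    exact ⟨i, by simp [hi], by simp [hi']⟩
  · intro i
    simp only [Finset.mem_filter, Finset.mem_univ, true_and]
    exact fun h h' => h (h1 i h')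

lemma exists_ray {d : ℕ} {ι : Type*} [Fintype ι] (L : ι → Fin d → ℤ) (R : ℕ) (hR : 1 ≤ R)
    (hL : ∀ i, ∑ j, |L i j| ≤ R) (hco : ∀ j, ∃ i, ∀ u, evF (L i) u = u j) :
    ∀ (N : ℕ) (u : Fin d → ℚ), nt L u = N → u ≠ 0 → (∀ i, 0 ≤ evF (L i) u) →
    ∃ g : Fin d → ℤ, g ≠ 0 ∧ (∀ i, 0 ≤ evF (L i) (fun j => (g j : ℚ))) ∧
      (∀ i, evF (L i) u = 0 → evF (L i) (fun j => (g j : ℚ)) = 0) ∧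
      ∀ j, |g j| ≤ (R : ℤ) ^ (d - 1) := by
  intro N
  induction N using Nat.strong_induction_on with
  | _ N ih =>
  intro u hN hu0 hu
  obtain ⟨g', hg0', hg', hgb'⟩ := kernel_small L R hR hL u hu0
  -- choose sign
  obtain ⟨g, hg0, hg, hgb, hpos⟩ : ∃ g : Fin d → ℤ, g ≠ 0 ∧
      (∀ i, evF (L i) u = 0 → evF (L i) (fun j => (g j : ℚ)) = 0) ∧
      (∀ j, |g j| ≤ (R : ℤ) ^ (d - 1)) ∧ ∃ i, 0 < evF (L i) (fun j => (g j : ℚ)) := by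
    obtain ⟨j, hj⟩ : ∃ j, g' j ≠ 0 := by
      by_contra! h
      exact hg0' (funext h)
    obtain ⟨i, hi⟩ := hco j
    rcases lt_or_gt_of_ne hj with h | h
    · have hneg : (fun j => (((-g') j : ℤ) : ℚ)) = (-1 : ℚ) • (fun j => (g' j : ℚ)) := by
        ext j; simp
      refine ⟨-g', by simpa using hg0', ?_, ?_, i, ?_⟩
      · intro k hk
        have := hg' k hk
        rw [hneg, evF_smul, this, mul_zero]
      · intro j; simpa using hgb' j
      · rw [hi]
        have : (0 : ℤ) < (-g') j := by simpa using h
        exact_mod_cast this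
    · exact ⟨g', hg0', hg', hgb', i, by rw [hi]; exact_mod_cast h⟩
  obtain ⟨t, ht0, h1, h2, h3⟩ := move_tight L u (fun j => (g j : ℚ)) hu hg hpos
  by_cases hz : u - t • (fun j => (g j : ℚ)) = 0
  · refine ⟨g, hg0, ?_, hg, hgb⟩
    intro i
    rw [sub_eq_zero] at hz
    have htp : 0 < t := by
      rcases ht0.lt_or_eq with h | h
      · exact h
      · exfalso; apply hu0; rw [hz, ← h]; simp
    have := hu i
    rw [hz, evF_smul] at this
    exact nonneg_of_mul_nonneg_right this htp
  · obtain ⟨r, hr0, hr, hrt, hrb⟩ := ih _ (hN ▸ nt_lt L u _ h2 h3) _ rfl hz h1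
    exact ⟨r, hr0, hr, fun i hi => hrt i (h2 i hi), hrb⟩

lemma cone_decomp {d : ℕ} {ι : Type*} [Fintype ι] (L : ι → Fin d → ℤ) (R : ℕ) (hR : 1 ≤ R)
    (hL : ∀ i, ∑ j, |L i j| ≤ R) (hco : ∀ j, ∃ i, ∀ u, evF (L i) u = u j) :
    ∀ (N : ℕ) (u : Fin d → ℚ), nt L u = N → (∀ i, 0 ≤ evF (L i) u) →
    ∃ (q : ℕ) (lam : Fin q → ℚ) (r : Fin q → Fin d → ℤ), q ≤ N ∧ (∀ k, 0 ≤ lam k) ∧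
      (∀ k i, 0 ≤ evF (L i) (fun j => (r k j : ℚ))) ∧ (∀ k j, |r k j| ≤ (R : ℤ) ^ (d - 1)) ∧
      u = ∑ k, lam k • (fun j => (r k j : ℚ)) := by
  intro N
  induction N using Nat.strong_induction_on with
  | _ N ih =>
  intro u hN hu
  by_cases hu0 : u = 0
  · exact ⟨0, Fin.elim0, Fin.elim0, by omega, fun k => k.elim0, fun k => k.elim0,
      fun k => k.elim0, by simp [hu0]⟩
  obtain ⟨g, hg0, hgc, hg, hgb⟩ := exists_ray L R hR hL hco N u hN hu0 hu
  have hpos : ∃ i, 0 < evF (L i) (fun j => (g j : ℚ)) := by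
    obtain ⟨j, hj⟩ : ∃ j, g j ≠ 0 := by
      by_contra! h
      exact hg0 (funext h)
    obtain ⟨i, hi⟩ := hco j
    refine ⟨i, lt_of_le_of_ne (hgc i) ?_⟩
    rw [hi]
    exact_mod_cast hj.symm
  obtain ⟨t, ht0, h1, h2, h3⟩ := move_tight L u (fun j => (g j : ℚ)) hu hg hpos
  have hlt := nt_lt L u _ h2 h3
  obtain ⟨q, lam, r, hq, hl, hr, hrb, he⟩ := ih _ (hN ▸ hlt) _ rfl h1
  refine ⟨q + 1, Fin.cons t lam, Fin.cons g r, by omega, ?_, ?_, ?_, ?_⟩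
  · intro k; refine Fin.cases ?_ (fun k => ?_) k
    · simpa using ht0
    · simpa using hl k
  · intro k; refine Fin.cases ?_ (fun k => ?_) k
    · simpa using hgc
    · simpa using hr k
  · intro k; refine Fin.cases ?_ (fun k => ?_) k
    · simpa using hgb
    · simpa using hrb k
  · rw [Fin.sum_univ_succ]
    simp only [Fin.cons_zero, Fin.cons_succ]
    rw [← he]
    abel

def SolZ {m n : ℕ} (A : Matrix (Fin m) (Fin (n + 1)) ℤ) (c : Fin m → ℤ) (z : Fin (n + 1) → ℤ) :
    Prop := (∀ j, 0 ≤ z j) ∧ ∀ i, c i ≤ ∑ j, A i j * z j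

lemma reduce_step {m n : ℕ} (A : Matrix (Fin m) (Fin (n + 1)) ℤ) (c : Fin m → ℤ) (al ga R : ℕ)
    (hA : ∀ i j, |A i j| ≤ al) (hc : ∀ i, |c i| ≤ ga) (hR : R = (n + 1) * al + ga) (hR1 : 1 ≤ R)
    (z : Fin (n + 1) → ℤ) (hz : SolZ A c z) (v : ℕ)
    (hbig : (R : ℤ) ^ (n + 1) + (m + n + 2) * (v * (R : ℤ) ^ (n + 1)) < z 0) :
    ∃ y : Fin (n + 1) → ℤ, SolZ A 0 y ∧ 1 ≤ y 0 ∧ y 0 ≤ (R : ℤ) ^ (n + 1) ∧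
      SolZ A c (fun j => z j - v * y j) := by
  classical
  let L : Fin m ⊕ Fin (n + 2) → Fin (n + 2) → ℤ :=
    Sum.elim (fun i => Fin.cons (-c i) (A i)) (fun j => Pi.single j 1)
  have hLl : ∀ i (u : Fin (n + 2) → ℚ),
      evF (L (Sum.inl i)) u = -(c i : ℚ) * u 0 + ∑ j, (A i j : ℚ) * u (Fin.succ j) := by
    intro i u
    simp [evF, L, Fin.sum_univ_succ (n := n + 1)]
  have hLr : ∀ j (u : Fin (n + 2) → ℚ), evF (L (Sum.inr j)) u = u j := by
    intro j u
    simp [evF, L, Pi.single_apply]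
  have hL : ∀ i, ∑ j, |L i j| ≤ R := by
    rintro (i | j)
    · simp only [L, Sum.elim_inl, Fin.sum_univ_succ (n := n + 1), Fin.cons_zero, Fin.cons_succ,
        abs_neg]
      have : ∑ j, |A i j| ≤ ∑ j : Fin (n + 1), (al : ℤ) := Finset.sum_le_sum fun j _ => hA i j
      simp only [Finset.sum_const, Finset.card_univ, Fintype.card_fin, nsmul_eq_mul] at this
      have h2 := hc i
      rw [hR]
      push_cast at this ⊢
      linarith
    · have : ∑ k, |L (Sum.inr j) k| = 1 := by
        simp only [L, Sum.elim_inr]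
        rw [Finset.sum_eq_single j]
        · simp
        · intro b _ hb; simp [Pi.single_apply, hb]
        · simp
      rw [this]
      exact_mod_cast hR1
  have hco : ∀ j, ∃ i, ∀ u, evF (L i) u = u j := fun j => ⟨Sum.inr j, hLr j⟩
  let u : Fin (n + 2) → ℚ := Fin.cons 1 (fun j => (z j : ℚ))
  have hu : ∀ i, 0 ≤ evF (L i) u := by
    rintro (i | j)
    · rw [hLl]
      simp only [u, Fin.cons_zero, Fin.cons_succ]
      have := hz.2 i
      have h2 : (c i : ℚ) ≤ ∑ j, (A i j : ℚ) * z j := by exact_mod_cast this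
      linarith
    · rw [hLr]
      refine Fin.cases ?_ (fun k => ?_) j
      · simp [u]
      · simp only [u, Fin.cons_succ]; exact_mod_cast hz.1 k
  obtain ⟨q, lam, r, hq, hl, hr, hrb, he⟩ := cone_decomp L R hR1 hL hco _ u rfl hu
  have hq' : q ≤ m + n + 2 := by
    refine hq.trans ?_
    unfold nt
    refine (Finset.card_le_univ _).trans ?_
    simp [add_assoc]
  have hr0 : ∀ k j, 0 ≤ r k j := by
    intro k j
    have := hr k (Sum.inr j)
    rw [hLr] at this
    exact_mod_cast this
  have hrK : ∀ k j, r k j ≤ (R : ℤ) ^ (n + 1) := fun k j => (le_abs_self _).trans (hrb k j)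
  have he0 : (1 : ℚ) = ∑ k, lam k * r k 0 := by
    have := congrFun he 0
    simpa [u, Finset.sum_apply] using this
  have hes : ∀ j : Fin (n + 1), (z j : ℚ) = ∑ k, lam k * r k j.succ := by
    intro j
    have := congrFun he j.succ
    simpa [u, Finset.sum_apply] using this
  obtain ⟨k, hk0, hk1, hkv⟩ : ∃ k, r k 0 = 0 ∧ 1 ≤ r k 1 ∧ (v : ℚ) ≤ lam k := by
    by_contra! hcon
    have hb : (z 0 : ℚ) ≤ (R : ℚ) ^ (n + 1) + q * (v * (R : ℚ) ^ (n + 1)) := by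
      have hterm : ∀ k, lam k * r k 1 ≤
          (R : ℚ) ^ (n + 1) * (lam k * r k 0) + v * (R : ℚ) ^ (n + 1) := by
        intro k
        have hK : (r k 1 : ℚ) ≤ (R : ℚ) ^ (n + 1) := by exact_mod_cast hrK k 1
        have hP : (0 : ℚ) ≤ (R : ℚ) ^ (n + 1) := by positivity
        have hv : (0 : ℚ) ≤ v * (R : ℚ) ^ (n + 1) := by positivity
        have h1 : (0 : ℚ) ≤ r k 1 := by exact_mod_cast hr0 k 1
        have hlk := hl k
        rcases (hr0 k 0).eq_or_lt with h | h
        · rcases (hr0 k 1).eq_or_lt with h' | h'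
          · rw [← h, ← h']; simpa using hv
          · have := hcon k h.symm h'
            have h3 : lam k * r k 1 ≤ v * (R : ℚ) ^ (n + 1) :=
              mul_le_mul this.le hK h1 (by positivity)
            rw [← h]; simpa using h3
        · have h4 : (1 : ℚ) ≤ r k 0 := by exact_mod_cast h
          have h5 : lam k * r k 1 ≤ lam k * (R : ℚ) ^ (n + 1) := by gcongr
          have h6 : lam k * (R : ℚ) ^ (n + 1) * 1 ≤ lam k * (R : ℚ) ^ (n + 1) * r k 0 := by
            gcongr
          linarith
      calc (z 0 : ℚ) = ∑ k, lam k * r k 1 := hes 0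
        _ ≤ ∑ k, ((R : ℚ) ^ (n + 1) * (lam k * r k 0) + v * (R : ℚ) ^ (n + 1)) :=
            Finset.sum_le_sum fun k _ => hterm k
        _ = _ := by
            rw [Finset.sum_add_distrib, ← Finset.mul_sum, ← he0]
            simp
    have hb2 : (z 0 : ℚ) ≤ (R : ℚ) ^ (n + 1) + (m + n + 2) * (v * (R : ℚ) ^ (n + 1)) := by
      refine hb.trans ?_
      have : (q : ℚ) ≤ m + n + 2 := by exact_mod_cast hq'
      gcongr
    have hb3 : z 0 ≤ (R : ℤ) ^ (n + 1) + (m + n + 2) * (v * (R : ℤ) ^ (n + 1)) := by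
      exact_mod_cast hb2
    linarith
  have hdiff : ∀ i, 0 ≤ evF (L i) (u - (v : ℚ) • (fun j => (r k j : ℚ))) := by
    intro i
    have hlin : evF (L i) u = ∑ k, lam k * evF (L i) (fun j => (r k j : ℚ)) := by
      rw [he]
      simp only [evF, Finset.sum_apply, Pi.smul_apply, smul_eq_mul, Finset.mul_sum]
      rw [Finset.sum_comm]
      exact Finset.sum_congr rfl fun _ _ => Finset.sum_congr rfl fun _ _ => by ring
    rw [evF_sub, evF_smul, hlin]
    have h1 : lam k * evF (L i) (fun j => (r k j : ℚ)) ≤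
        ∑ k, lam k * evF (L i) (fun j => (r k j : ℚ)) :=
      Finset.single_le_sum (f := fun k => lam k * evF (L i) (fun j => (r k j : ℚ)))
        (fun k _ => mul_nonneg (hl k) (hr k i)) (Finset.mem_univ k)
    have h2 := mul_le_mul_of_nonneg_right hkv (hr k i)
    linarith
  refine ⟨fun j => r k j.succ, ⟨fun j => hr0 k _, ?_⟩, hk1, hrK k 1, fun j => ?_, fun i => ?_⟩
  · intro i
    have := hr k (Sum.inl i)
    rw [hLl, hk0] at this
    simp only [Int.cast_zero, mul_zero, zero_add] at this
    exact_mod_cast this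
  · have := hdiff (Sum.inr j.succ)
    rw [hLr] at this
    simp only [u, Pi.sub_apply, Fin.cons_succ, Pi.smul_apply, smul_eq_mul] at this
    exact_mod_cast this
  · have := hdiff (Sum.inl i)
    rw [hLl] at this
    simp only [u, Pi.sub_apply, Fin.cons_succ, Fin.cons_zero, Pi.smul_apply, smul_eq_mul, hk0,
      Int.cast_zero, mul_zero, sub_zero, mul_one] at this
    have h2 : (c i : ℚ) ≤ ∑ j, (A i j : ℚ) * ((z j : ℚ) - v * r k j.succ) := by linarith
    exact_mod_cast h2

lemma reduce_full {m n : ℕ} (A : Matrix (Fin m) (Fin (n + 1)) ℤ) (c : Fin m → ℤ) (al ga R : ℕ)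
    (hA : ∀ i j, |A i j| ≤ al) (hc : ∀ i, |c i| ≤ ga) (hR : R = (n + 1) * al + ga) (hR1 : 1 ≤ R)
    (v : ℕ) (hv : 1 ≤ v) : ∀ (N : ℕ) (z : Fin (n + 1) → ℤ), SolZ A c z → (z 0).toNat = N →
    ∃ z', SolZ A c z' ∧ z' 0 ≤ (R : ℤ) ^ (n + 1) + (m + n + 2) * (v * (R : ℤ) ^ (n + 1)) ∧
      (v : ℤ) ∣ z 0 - z' 0 := by
  intro N
  induction N using Nat.strong_induction_on with
  | _ N ih =>
  intro z hz hN
  by_cases h : z 0 ≤ (R : ℤ) ^ (n + 1) + (m + n + 2) * (v * (R : ℤ) ^ (n + 1))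
  · exact ⟨z, hz, h, by simp⟩
  push Not at h
  obtain ⟨y, hy, hy1, -, hzy⟩ := reduce_step A c al ga R hA hc hR hR1 z hz v h
  have h1 := hzy.1 0
  have h2 : (1 : ℤ) ≤ v * y 0 := by
    have : (1 : ℤ) ≤ v := by exact_mod_cast hv
    nlinarith
  simp only at h1
  obtain ⟨z', hz', hb, hd⟩ := ih _ (by omega) _ hzy rfl
  refine ⟨z', hz', hb, ?_⟩
  have : z 0 - z' 0 = (z 0 - v * y 0 - z' 0) + v * y 0 := by ring
  rw [this]
  exact dvd_add hd (dvd_mul_right _ _)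

lemma solZ_add {m n : ℕ} (A : Matrix (Fin m) (Fin (n + 1)) ℤ) (c : Fin m → ℤ)
    (z y : Fin (n + 1) → ℤ) (hz : SolZ A c z) (hy : SolZ A 0 y) (k : ℕ) :
    SolZ A c (fun j => z j + k * y j) := by
  refine ⟨fun j => ?_, fun i => ?_⟩
  · have := hz.1 j
    have := hy.1 j
    positivity
  · have h1 := hz.2 i
    have h2 := hy.2 i
    have : ∑ j, A i j * (z j + k * y j) = ∑ j, A i j * z j + k * ∑ j, A i j * y j := by
      rw [Finset.mul_sum, ← Finset.sum_add_distrib]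
      exact Finset.sum_congr rfl fun _ _ => by ring
    rw [this]
    simp only [Pi.zero_apply] at h2
    have : 0 ≤ (k : ℤ) * ∑ j, A i j * y j := by positivity
    linarith

lemma exists_iff_solZ {m n : ℕ} (A : Matrix (Fin m) (Fin (n + 1)) ℤ) (c : Fin m → ℤ) (a : ℕ) :
    (∃ x : Fin n → ℕ, ∀ i : Fin m,
      c i ≤ ∑ j : Fin (n + 1), A i j * ((Fin.cons a x : Fin (n + 1) → ℕ) j : ℤ)) ↔
    ∃ z, SolZ A c z ∧ z 0 = a := by
  constructor
  · rintro ⟨x, hx⟩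
    exact ⟨fun j => ((Fin.cons a x : Fin (n + 1) → ℕ) j : ℤ), ⟨fun j => by positivity, hx⟩, by simp⟩
  · rintro ⟨z, hz, h0⟩
    refine ⟨fun j => (z j.succ).toNat, fun i => ?_⟩
    convert hz.2 i using 3 with j
    refine Fin.cases ?_ (fun k => ?_) j
    · simp [h0]
    · simp [hz.1 k.succ]

lemma numeric_bound (m n al ga R : ℕ) (hm : 1 ≤ m) (hal : 1 ≤ al) (hR : R = (n + 1) * al + ga) :
    (m + n + 2) * (R ^ (n + 1) * R ^ (n + 1)) ≤ ((R + 2) ^ (m + n + 1)) ^ 2 := by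
  have h1 : n + 1 ≤ R := by rw [hR]; nlinarith
  have h2 : m + n + 2 ≤ (R + 2) ^ m := by
    have hb : 1 + m * (n + 2) ≤ (1 + (n + 2)) ^ m := by
      have := one_add_mul_le_pow (R := ℤ) (a := (n + 2 : ℤ)) (by omega) m
      exact_mod_cast this
    have hc : (1 + (n + 2)) ^ m ≤ (R + 2) ^ m := Nat.pow_le_pow_left (by omega) m
    nlinarith
  calc (m + n + 2) * (R ^ (n + 1) * R ^ (n + 1))
      ≤ (R + 2) ^ m * ((R + 2) ^ (n + 1) * (R + 2) ^ (n + 1)) := by gcongr <;> omega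
    _ = (R + 2) ^ (m + 2 * (n + 1)) := by ring
    _ ≤ (R + 2) ^ ((m + n + 1) * 2) := Nat.pow_le_pow_right (by omega) (by omega)
    _ = _ := by rw [pow_mul]

/-- Arithmetical core of the upper bound of Theorem 2: the projection onto the
first coordinate of the nonnegative solutions of `A·x ≥ c` is ultimately
periodic with threshold at most `K + K²` and period dividing `lcm{1,…,K}`,
where `K = ((n+1)‖A‖ + ‖c‖ + 2)^(m+n+1)`. -/
theorem projection_ultimately_periodic (m n : ℕ)
    (A : Matrix (Fin m) (Fin (n + 1)) ℤ) (c : Fin m → ℤ) :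
    ∃ t p : ℕ,
      t ≤ ((n + 1) * (Finset.univ.sup fun i' : Fin m =>
              Finset.univ.sup fun j' : Fin (n + 1) => (A i' j').natAbs) +
            (Finset.univ.sup fun i' : Fin m => (c i').natAbs) + 2) ^ (m + n + 1) +
          (((n + 1) * (Finset.univ.sup fun i' : Fin m =>
              Finset.univ.sup fun j' : Fin (n + 1) => (A i' j').natAbs) +
            (Finset.univ.sup fun i' : Fin m => (c i').natAbs) + 2) ^ (m + n + 1)) ^ 2 ∧
      0 < p ∧
      p ∣ (Finset.Icc 1
            (((n + 1) * (Finset.univ.sup fun i' : Fin m =>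
                Finset.univ.sup fun j' : Fin (n + 1) => (A i' j').natAbs) +
              (Finset.univ.sup fun i' : Fin m => (c i').natAbs) + 2) ^ (m + n + 1))).lcm id ∧
      ∀ a : ℕ, t ≤ a →
        ((∃ x : Fin n → ℕ, ∀ i : Fin m,
            c i ≤ ∑ j : Fin (n + 1), A i j * ((Fin.cons a x : Fin (n + 1) → ℕ) j : ℤ)) ↔
          (∃ x : Fin n → ℕ, ∀ i : Fin m,
            c i ≤ ∑ j : Fin (n + 1), A i j * ((Fin.cons (a + p) x : Fin (n + 1) → ℕ) j : ℤ))) := by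
  set al : ℕ := Finset.univ.sup fun i' : Fin m =>
    Finset.univ.sup fun j' : Fin (n + 1) => (A i' j').natAbs with hal
  set ga : ℕ := Finset.univ.sup fun i' : Fin m => (c i').natAbs with hga
  have hA : ∀ i j, |A i j| ≤ (al : ℤ) := by
    intro i j
    have h1 : (A i j).natAbs ≤ Finset.univ.sup fun j' : Fin (n + 1) => (A i j').natAbs :=
      Finset.le_sup (f := fun j' : Fin (n + 1) => (A i j').natAbs) (Finset.mem_univ j)
    have h2 : (Finset.univ.sup fun j' : Fin (n + 1) => (A i j').natAbs) ≤ al :=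
      Finset.le_sup (f := fun i' : Fin m =>
        Finset.univ.sup fun j' : Fin (n + 1) => (A i' j').natAbs) (Finset.mem_univ i)
    rw [Int.abs_eq_natAbs]
    exact_mod_cast h1.trans h2
  have hc : ∀ i, |c i| ≤ (ga : ℤ) := by
    intro i
    have h1 : (c i).natAbs ≤ ga :=
      Finset.le_sup (f := fun i' : Fin m => (c i').natAbs) (Finset.mem_univ i)
    rw [Int.abs_eq_natAbs]
    exact_mod_cast h1
  clear_value al ga
  by_cases hal0 : al = 0
  · have hz : ∀ i j, A i j = 0 := by
      intro i j
      have := hA i j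
      rw [hal0] at this
      exact abs_nonpos_iff.1 (by exact_mod_cast this)
    refine ⟨0, 1, Nat.zero_le _, one_pos, one_dvd _, ?_⟩
    intro a _
    simp [hz]
  have hm : 1 ≤ m := by
    by_contra h
    have hm0 : m = 0 := by omega
    subst hm0
    simp at hal
    exact hal0 hal
  obtain ⟨R, hR⟩ : ∃ R, R = (n + 1) * al + ga := ⟨_, rfl⟩
  have hR1 : 1 ≤ R := by rw [hR]; have : 1 ≤ al := by omega
                         nlinarith
  have hnum := numeric_bound m n al ga R hm (by omega) hR
  rw [← hR]
  have hK0 : R ^ (n + 1) ≤ (R + 2) ^ (m + n + 1) :=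
    (Nat.pow_le_pow_left (by omega) _).trans (Nat.pow_le_pow_right (by omega) (by omega))
  have hKpos : 1 ≤ ((R + 2) ^ (m + n + 1)) ^ 2 := Nat.one_le_iff_ne_zero.2 (by positivity)
  simp only [exists_iff_solZ]
  by_cases hy : ∃ y, SolZ A 0 y ∧ 1 ≤ y 0 ∧ y 0 ≤ (R : ℤ) ^ (n + 1)
  · obtain ⟨y, hy, hy1, hyK⟩ := hy
    obtain ⟨v, hv⟩ : ∃ v : ℕ, y 0 = v := ⟨(y 0).toNat, by omega⟩
    rw [hv] at hy1 hyK
    have hv1 : 1 ≤ v := by exact_mod_cast hy1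
    have hvK : v ≤ R ^ (n + 1) := by exact_mod_cast hyK
    refine ⟨R ^ (n + 1) + (m + n + 2) * (v * R ^ (n + 1)), v, ?_, hv1, ?_, ?_⟩
    · have : (m + n + 2) * (v * R ^ (n + 1)) ≤ (m + n + 2) * (R ^ (n + 1) * R ^ (n + 1)) := by
        gcongr
      omega
    · exact Finset.dvd_lcm (f := id) (Finset.mem_Icc.2 ⟨hv1, hvK.trans hK0⟩)
    · intro a ha
      constructor
      · rintro ⟨z, hz, h0⟩
        refine ⟨_, solZ_add A c z y hz hy 1, ?_⟩
        simp [h0, hv]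
      · rintro ⟨z, hz, h0⟩
        obtain ⟨z', hz', hb, e, hd⟩ := reduce_full A c al ga R hA hc hR hR1 v hv1 _ z hz rfl
        have hza : z' 0 ≤ a := by
          refine hb.trans ?_
          exact_mod_cast ha
        have he : (v : ℤ) * (e - 1) = a - z' 0 := by
          rw [h0] at hd
          push_cast at hd
          linarith
        have he0 : 0 ≤ e - 1 := by
          by_contra hneg
          push Not at hneg
          have : (1 : ℤ) ≤ v := by exact_mod_cast hv1
          nlinarith
        obtain ⟨k, hk⟩ := Int.eq_ofNat_of_zero_le he0
        refine ⟨_, solZ_add A c z' y hz' hy k, ?_⟩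
        rw [hv, ← hk]
        linarith
  · have hsmall : ∀ z, SolZ A c z → z 0 ≤ (R : ℤ) ^ (n + 1) := by
      intro z hz
      by_contra hcon
      push Not at hcon
      obtain ⟨y, h1, h2, h3, -⟩ := reduce_step A c al ga R hA hc hR hR1 z hz 0 (by simpa using hcon)
      exact hy ⟨y, h1, h2, h3⟩
    refine ⟨R ^ (n + 1) + 1, 1, by omega, one_pos, one_dvd _, ?_⟩
    intro a ha
    constructor
    · rintro ⟨z, hz, h0⟩
      have := hsmall z hz
      rw [h0] at this
      have : a ≤ R ^ (n + 1) := by exact_mod_cast this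
      omega
    · rintro ⟨z, hz, h0⟩
      have := hsmall z hz
      rw [h0] at this
      have : a + 1 ≤ R ^ (n + 1) := by exact_mod_cast this
      omega
end
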